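/- There exist an uncountable index set Λ and a family {(X_λ, f_λ) : λ ∈ Λ} such that: for each λ ∈ Λ, X_λ is a Lelek-like fan; for each λ ∈ Λ, f_λ : X_λ → X_λ is a continuous surjection that is not injective (a non-invertible mapping) and the dynamical system (X_λ, f_λ) is topologically mixing; and for all λ₁, λ₂ ∈ Λ with λ₁ ≠ λ₂, the spaces X_{λ₁} and X_{λ₂} are not homeomorphic. -/

import Mathlib

open Set Filter Topology

/-- A set `A` is an arc if it is homeomorphic to the closed unit interval `[0,1]`. -/
def IsArc {X : Type} [TopologicalSpace X] (A : Set X) : Prop :=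
  Nonempty (↥(Set.Icc (0:ℝ) 1) ≃ₜ ↥A)

/-- `x` is an end-point of the arc `A`: some homeomorphism `[0,1] ≃ₜ A` sends `0` to `x`. -/
def IsArcEndpoint {X : Type} [TopologicalSpace X] (A : Set X) (x : X) : Prop :=
  ∃ e : ↥(Set.Icc (0:ℝ) 1) ≃ₜ ↥A, ((e ⟨0, le_refl 0, zero_le_one⟩ : A) : X) = x

/-- A subcontinuum: a nonempty compact connected subset. -/
def IsSubcontinuum {X : Type} [TopologicalSpace X] (A : Set X) : Prop :=
  IsCompact A ∧ IsConnected A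

/-- Every subcontinuum `C` is unicoherent: whenever `C = A ∪ B` with `A`, `B`
subcontinua, the intersection `A ∩ B` is connected. -/
def HereditarilyUnicoherent (X : Type) [TopologicalSpace X] : Prop :=
  ∀ C A B : Set X, IsSubcontinuum C → IsSubcontinuum A → IsSubcontinuum B →
    A ∪ B = C → IsConnected (A ∩ B)

/-- A dendroid: an arcwise connected, hereditarily unicoherent (metrizable) continuum. -/
def IsDendroid (X : Type) [TopologicalSpace X] : Prop :=
  Nonempty X ∧ CompactSpace X ∧ ConnectedSpace X ∧ TopologicalSpace.MetrizableSpace X ∧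
  (∀ x y : X, x ≠ y → ∃ A : Set X, IsArcEndpoint A x ∧ IsArcEndpoint A y) ∧
  HereditarilyUnicoherent X

/-- The set of end-points of a dendroid: points which are end-points of every arc
containing them. -/
def DendroidEndpoints (X : Type) [TopologicalSpace X] : Set X :=
  {x | ∀ A : Set X, IsArc A → x ∈ A → IsArcEndpoint A x}

/-- The model simple triode `([-1,1] × {0}) ∪ ({0} × [0,1]) ⊆ ℝ²`. -/
def TSet : Set (ℝ × ℝ) := (Set.Icc (-1:ℝ) 1 ×ˢ ({0} : Set ℝ)) ∪ (({0} : Set ℝ) ×ˢ Set.Icc (0:ℝ) 1)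

lemma zero_mem_TSet : ((0:ℝ), (0:ℝ)) ∈ TSet :=
  Or.inl ⟨⟨by norm_num, by norm_num⟩, rfl⟩

/-- `T` is a simple triode with top `x`: some homeomorphism from the model triode onto `T`
sends `(0,0)` to `x`. -/
def IsSimpleTriodeWithTop {X : Type} [TopologicalSpace X] (T : Set X) (x : X) : Prop :=
  ∃ e : ↥TSet ≃ₜ ↥T, ((e ⟨((0:ℝ), (0:ℝ)), zero_mem_TSet⟩ : T) : X) = x

/-- `x` is a ramification point: the top of some simple triode contained in the space. -/
def IsRamificationPoint {X : Type} [TopologicalSpace X] (x : X) : Prop :=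
  ∃ T : Set X, IsSimpleTriodeWithTop T x

/-- A fan: a dendroid with at most one ramification point. -/
def IsFan (X : Type) [TopologicalSpace X] : Prop :=
  IsDendroid X ∧ ∀ x y : X, IsRamificationPoint x → IsRamificationPoint y → x = y

/-- `v` is the top of the fan: its ramification point if one exists, otherwise an end-point. -/
def IsFanTop {X : Type} [TopologicalSpace X] (v : X) : Prop :=
  IsRamificationPoint v ∨
    ((∀ x : X, ¬ IsRamificationPoint x) ∧ v ∈ DendroidEndpoints X)

/-- A Lelek-like fan: a fan whose set of end-points is dense. -/
def IsLelekLikeFan (X : Type) [TopologicalSpace X] : Prop :=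
  IsFan X ∧ Dense (DendroidEndpoints X)
/-- A dynamical system is topologically mixing if for all nonempty open sets `U`, `V`
there is `n₀` such that `f^[n] '' U` meets `V` for every `n ≥ n₀`. -/
def TopologicallyMixing {X : Type} [TopologicalSpace X] (f : X → X) : Prop :=
  ∀ U V : Set X, IsOpen U → IsOpen V → U.Nonempty → V.Nonempty →
    ∃ n₀ : ℕ, ∀ n : ℕ, n₀ ≤ n → (f^[n] '' U ∩ V).Nonempty

/-- A dynamical system is (topologically) transitive if for all nonempty open sets `U`, `V`
there is `n ≥ 0` such that `f^[n] '' U` meets `V`. -/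
def TopologicallyTransitive {X : Type} [TopologicalSpace X] (f : X → X) : Prop :=
  ∀ U V : Set X, IsOpen U → IsOpen V → U.Nonempty → V.Nonempty →
    ∃ n : ℕ, (f^[n] '' U ∩ V).Nonempty

open unitInterval

/-- A presentation of a space as a union of legs, i.e. arcs issuing from a common point `v` and
pairwise meeting only in `v`, such that every connected set avoiding `v` lies in a single leg. -/
structure IsLegSystem {X ι : Type} [TopologicalSpace X] (v : X) (γ : ι → I → X) : Prop where
  continuous_leg : ∀ i, Continuous (γ i)
  injective_leg : ∀ i, Function.Injective (γ i)
  leg_zero : ∀ i, γ i 0 = v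
  exists_leg : ∀ x, ∃ i a, γ i a = x
  eq_of_meet : ∀ i j a b, γ i a = γ j b → γ i a ≠ v → i = j
  subset_leg : ∀ K : Set X, IsPreconnected K → v ∉ K → ∃ i, K ⊆ range (γ i)

/-- In a compact Hausdorff space, a neighbourhood of a connected component contains a clopen set
around the base point. -/
lemma exists_isClopen_subset_of_connectedComponent_subset {Z : Type} [TopologicalSpace Z]
    [CompactSpace Z] [T2Space Z] (x : Z) {O : Set Z} (hO : IsOpen O)
    (h : connectedComponent x ⊆ O) : ∃ Q : Set Z, IsClopen Q ∧ x ∈ Q ∧ Q ⊆ O := by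
  have : Nonempty {s : Set Z // IsClopen s ∧ x ∈ s} := ⟨⟨univ, isClopen_univ, mem_univ x⟩⟩
  have key := exists_subset_nhds_of_isCompact'
    (V := fun s : {s : Set Z // IsClopen s ∧ x ∈ s} => (s : Set Z)) (U := O)
    ?_ ?_ ?_ ?_
  · obtain ⟨s, hs⟩ := key
    exact ⟨s, s.2.1, s.2.2, hs⟩
  · intro s t
    exact ⟨⟨s ∩ t, s.2.1.inter t.2.1, s.2.2, t.2.2⟩, inter_subset_left, inter_subset_right⟩
  · exact fun s => s.2.1.1.isCompact
  · exact fun s => s.2.1.1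
  · intro y hy
    rw [← connectedComponent_eq_iInter_isClopen] at hy
    exact hO.mem_nhds (h hy)

namespace IsLegSystem

variable {X ι : Type} [TopologicalSpace X] {v : X} {γ : ι → I → X}

lemma leg_ne_of_ne_zero (h : IsLegSystem v γ) {i : ι} {a : I} (ha : a ≠ 0) : γ i a ≠ v := by
  rw [← h.leg_zero i]
  exact fun h' => ha (h.injective_leg i h')

lemma subset_leg_of_mem (h : IsLegSystem v γ) {K : Set X} (hK : IsPreconnected K) (hv : v ∉ K)
    {i : ι} {a : I} (ha : γ i a ∈ K) : K ⊆ range (γ i) := by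
  obtain ⟨j, hj⟩ := h.subset_leg K hK hv
  obtain ⟨b, hb⟩ := hj ha
  have : i = j := h.eq_of_meet i j a b hb.symm fun h' => hv (h' ▸ ha)
  rwa [this]

lemma isPreconnected_univ (h : IsLegSystem v γ) : IsPreconnected (univ : Set X) := by
  have : (univ : Set X) = ⋃ i, range (γ i) := by
    rw [eq_comm, eq_univ_iff_forall]
    intro y
    obtain ⟨i, a, rfl⟩ := h.exists_leg y
    exact mem_iUnion.2 ⟨i, mem_range_self a⟩
  rw [this]
  exact isPreconnected_iUnion ⟨v, mem_iInter.2 fun i => ⟨0, h.leg_zero i⟩⟩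
    fun i => isPreconnected_range (h.continuous_leg i)

variable [T2Space X]

lemma ordConnected_preimage_of_subset (h : IsLegSystem v γ) {K : Set X} (hK : IsPreconnected K)
    {i : ι} (hi : K ⊆ range (γ i)) : OrdConnected (γ i ⁻¹' K) := by
  have e := (h.continuous_leg i).isClosedEmbedding (h.injective_leg i)
  refine IsPreconnected.ordConnected ?_
  rw [← e.isInducing.isPreconnected_image, image_preimage_eq_of_subset hi]
  exact hK

/-- A subcontinuum through `v` contains, with each of its points, the arc joining it to `v`. -/
lemma mem_of_le (h : IsLegSystem v γ) {A : Set X} (hA : IsSubcontinuum A) (hv : v ∈ A) {i : ι}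
    {a b : I} (hab : a ≤ b) (hb : γ i b ∈ A) : γ i a ∈ A := by
  by_contra ha
  have ha0 : a ≠ 0 := by
    rintro rfl
    exact ha (by rwa [h.leg_zero])
  have hS : IsCompact (γ i '' Ici a) := isClosed_Ici.isCompact.image (h.continuous_leg i)
  have hvS : v ∉ γ i '' Ici a := by
    rintro ⟨c, hc, hc'⟩
    refine h.leg_ne_of_ne_zero (i := i) (a := c) ?_ hc'
    rintro rfl
    exact ha0 (le_antisymm hc a.2.1)
  obtain ⟨W, O, hW, hO, hvW, hSO, hWO⟩ := SeparatedNhds.of_isCompact_isCompact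
    (isCompact_singleton (x := v)) hS (by simpa using hvS)
  have hvW : v ∈ W := by simpa using hvW
  have hAW : IsCompact (A \ W) := hA.1.diff hW
  have : CompactSpace ↥(A \ W) := isCompact_iff_compactSpace.1 hAW
  have hbO : γ i b ∈ O := hSO ⟨b, hab, rfl⟩
  set x : ↥(A \ W) := ⟨γ i b, hb, fun h' => hWO.le_bot ⟨h', hbO⟩⟩ with hx
  obtain ⟨Q, hQ, hxQ, hQO⟩ := exists_isClopen_subset_of_connectedComponent_subset x
    (hO.preimage continuous_subtype_val) (by
      have hK : IsPreconnected (Subtype.val '' connectedComponent x) :=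
        isPreconnected_connectedComponent.image _ continuous_subtype_val.continuousOn
      have hvK : v ∉ Subtype.val '' connectedComponent x := by
        rintro ⟨y, -, hy⟩
        exact y.2.2 (hy ▸ hvW)
      have hbK : γ i b ∈ Subtype.val '' connectedComponent x :=
        ⟨x, mem_connectedComponent, rfl⟩
      have hKi := h.subset_leg_of_mem hK hvK hbK
      have hoc := h.ordConnected_preimage_of_subset hK hKi
      intro y hy
      obtain ⟨c, hc⟩ := hKi ⟨y, hy, rfl⟩
      refine hSO ⟨c, ?_, hc⟩
      by_contra hca
      have : a ∈ γ i ⁻¹' (Subtype.val '' connectedComponent x) :=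
        hoc.out (by rw [mem_preimage, hc]; exact ⟨y, hy, rfl⟩) hbK ⟨(not_le.1 hca).le, hab⟩
      obtain ⟨z, -, hz⟩ := this
      exact ha (hz ▸ z.2.1))
  have hQ1 : IsClosed (Subtype.val '' Q) :=
    (hQ.1.isCompact.image continuous_subtype_val).isClosed
  have hQ2 : IsClosed (Subtype.val '' Qᶜ ∪ A ∩ Oᶜ) :=
    (hQ.compl.1.isCompact.image continuous_subtype_val).isClosed.union
      (hA.1.isClosed.inter hO.isClosed_compl)
  obtain ⟨z, -, ⟨y, hy, rfl⟩, hz⟩ := isPreconnected_closed_iff.1 hA.2.isPreconnected _ _ hQ1 hQ2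
    (by
      intro p hp
      by_cases hpW : p ∈ W
      · exact Or.inr (Or.inr ⟨hp, fun h' => hWO.le_bot ⟨hpW, h'⟩⟩)
      · by_cases hpQ : (⟨p, hp, hpW⟩ : ↥(A \ W)) ∈ Q
        · exact Or.inl ⟨_, hpQ, rfl⟩
        · exact Or.inr (Or.inl ⟨_, hpQ, rfl⟩))
    ⟨_, hb, x, hxQ, rfl⟩ ⟨v, hv, Or.inr ⟨hv, fun h' => hWO.le_bot ⟨hvW, h'⟩⟩⟩
  rcases hz with ⟨y', hy', hyy⟩ | hz
  · exact hy' (Subtype.ext hyy ▸ hy)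
  · exact hz.2 (hQO hy)

lemma ordConnected_preimage (h : IsLegSystem v γ) {A : Set X} (hA : IsSubcontinuum A) (i : ι) :
    OrdConnected (γ i ⁻¹' A) := by
  by_cases hv : v ∈ A
  · exact ⟨fun a _ b hb c hc => h.mem_of_le hA hv hc.2 hb⟩
  · by_cases hi : (γ i ⁻¹' A).Nonempty
    · obtain ⟨a, ha⟩ := hi
      exact h.ordConnected_preimage_of_subset hA.2.isPreconnected
        (h.subset_leg_of_mem hA.2.isPreconnected hv ha)
    · rw [not_nonempty_iff_eq_empty.1 hi]
      exact ordConnected_empty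

/-- The intersection of two subcontinua meets each leg in a connected set. -/
lemma isPreconnected_inter_range (h : IsLegSystem v γ) {A B : Set X} (hA : IsSubcontinuum A)
    (hB : IsSubcontinuum B) (i : ι) : IsPreconnected (A ∩ B ∩ range (γ i)) := by
  have h1 := (h.ordConnected_preimage hA i).inter (h.ordConnected_preimage hB i)
  rw [← preimage_inter] at h1
  rw [← image_preimage_eq_inter_range]
  exact h1.isPreconnected.image _ (h.continuous_leg i).continuousOn

lemma hereditarilyUnicoherent (h : IsLegSystem v γ) : HereditarilyUnicoherent X := by
  intro C A B hC hA hB hAB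
  have hne : (A ∩ B).Nonempty := by
    obtain ⟨x, -, hx⟩ := isPreconnected_closed_iff.1 hC.2.isPreconnected A B hA.1.isClosed
      hB.1.isClosed hAB.ge
      (by rw [← hAB, union_inter_cancel_left]; exact hA.2.nonempty)
      (by rw [← hAB, union_inter_cancel_right]; exact hB.2.nonempty)
    exact ⟨x, hx⟩
  refine ⟨hne, ?_⟩
  obtain ⟨x, hx⟩ := hne
  have aux : ∀ D : Set X, IsSubcontinuum D → v ∉ D → A ∩ B ⊆ D → IsPreconnected (A ∩ B) := by
    intro D hD hvD hsub
    obtain ⟨i, hi⟩ := h.subset_leg D hD.2.isPreconnected hvD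
    rw [← inter_eq_self_of_subset_left (hsub.trans hi)]
    exact h.isPreconnected_inter_range hA hB i
  by_cases hvA : v ∈ A
  · by_cases hvB : v ∈ B
    · have : A ∩ B = ⋃ i, A ∩ B ∩ range (γ i) := by
        rw [← inter_iUnion, eq_comm, inter_eq_left]
        intro y _
        obtain ⟨i, a, rfl⟩ := h.exists_leg y
        exact mem_iUnion.2 ⟨i, mem_range_self a⟩
      rw [this]
      exact isPreconnected_iUnion
        ⟨v, mem_iInter.2 fun i => ⟨⟨hvA, hvB⟩, 0, h.leg_zero i⟩⟩
        fun i => h.isPreconnected_inter_range hA hB i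
    · exact aux B hB hvB inter_subset_right
  · exact aux A hA hvA inter_subset_left

end IsLegSystem

lemma isArcEndpoint_range_zero {X : Type} [TopologicalSpace X] [T2Space X] {f : I → X}
    (hf : Continuous f) (hi : Function.Injective f) : IsArcEndpoint (range f) (f 0) := by
  refine ⟨(hf.isClosedEmbedding hi).isEmbedding.toHomeomorph, ?_⟩
  rfl

lemma IsArcEndpoint.of_homeomorph_one {X : Type} [TopologicalSpace X] {A : Set X} (e : I ≃ₜ A) :
    IsArcEndpoint A (e 1 : X) := by
  refine ⟨unitInterval.symmHomeomorph.trans e, ?_⟩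
  have : unitInterval.symmHomeomorph (⟨0, le_refl 0, zero_le_one⟩ : I) = 1 :=
    unitInterval.symm_zero
  simp only [Homeomorph.trans_apply]
  rw [this]

/-- A curve that is injective on `[-1,1]` yields arcs between any two of its points. -/
lemma exists_arc_of_injOn {X : Type} [TopologicalSpace X] [T2Space X] {G : ℝ → X}
    (hG : Continuous G) (hi : InjOn G (Icc (-1) 1)) {p q : ℝ} (hp : p ∈ Icc (-1 : ℝ) 1)
    (hq : q ∈ Icc (-1 : ℝ) 1) (hpq : p ≠ q) :
    ∃ A : Set X, IsArcEndpoint A (G p) ∧ IsArcEndpoint A (G q) := by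
  set f : I → X := fun t => G (p + t * (q - p)) with hfdef
  have hf : Continuous f := by fun_prop
  have hmem : ∀ t : I, p + t * (q - p) ∈ Icc (-1 : ℝ) 1 := by
    intro t
    have := convex_Icc (-1 : ℝ) 1 hp hq (sub_nonneg.2 t.2.2) t.2.1 (by ring)
    convert this using 1
    simp only [smul_eq_mul]
    ring
  have hfi : Function.Injective f := by
    intro s t hst
    have h1 := hi (hmem s) (hmem t) hst
    have h2 : (s : ℝ) * (q - p) = t * (q - p) := by linarith
    exact Subtype.ext (mul_right_cancel₀ (sub_ne_zero.2 hpq.symm) h2)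
  have h0 : f 0 = G p := by simp [hfdef]
  have h1 : f 1 = G q := by simp [hfdef]
  refine ⟨range f, h0 ▸ isArcEndpoint_range_zero hf hfi, ?_⟩
  rw [← h1]
  exact IsArcEndpoint.of_homeomorph_one (hf.isClosedEmbedding hfi).isEmbedding.toHomeomorph

namespace IsLegSystem

variable {X ι : Type} [TopologicalSpace X] {v : X} {γ : ι → I → X} [T2Space X]

lemma exists_arc (h : IsLegSystem v γ) {x y : X} (hxy : x ≠ y) :
    ∃ A : Set X, IsArcEndpoint A x ∧ IsArcEndpoint A y := by
  have aux : ∀ i a b, γ i a ≠ γ i b →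
      ∃ A : Set X, IsArcEndpoint A (γ i a) ∧ IsArcEndpoint A (γ i b) := by
    intro i a b hab
    set f : I → X := fun t => γ i (projIcc 0 1 zero_le_one ((a : ℝ) + t * (b - a))) with hfdef
    have hf : Continuous f := (h.continuous_leg i).comp (continuous_projIcc.comp (by fun_prop))
    have hmem : ∀ t : I, (a : ℝ) + t * (b - a) ∈ Icc (0 : ℝ) 1 := by
      intro t
      have := convex_Icc (0 : ℝ) 1 a.2 b.2 (sub_nonneg.2 t.2.2) t.2.1 (by ring)
      convert this using 1
      simp only [smul_eq_mul]
      ring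
    have hne : (b : ℝ) - a ≠ 0 := sub_ne_zero.2 fun h' => hab (by rw [Subtype.ext h'.symm])
    have hfi : Function.Injective f := by
      intro s t hst
      have h1 := h.injective_leg i hst
      rw [projIcc_of_mem _ (hmem s), projIcc_of_mem _ (hmem t), Subtype.mk.injEq] at h1
      exact Subtype.ext (mul_right_cancel₀ hne (by linarith))
    have h0 : f 0 = γ i a := by simp [hfdef]
    have h1 : f 1 = γ i b := by simp [hfdef]
    rw [← h0, ← h1]
    exact ⟨range f, isArcEndpoint_range_zero hf hfi,
      IsArcEndpoint.of_homeomorph_one (hf.isClosedEmbedding hfi).isEmbedding.toHomeomorph⟩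
  obtain ⟨i, a, rfl⟩ := h.exists_leg x
  obtain ⟨j, b, rfl⟩ := h.exists_leg y
  by_cases hij : i = j
  · subst hij
    exact aux i a b hxy
  set G : ℝ → X := fun s => if s ≤ 0 then γ i (projIcc 0 1 zero_le_one (-s))
    else γ j (projIcc 0 1 zero_le_one s) with hGdef
  have hG : Continuous G := by
    refine Continuous.if_le ((h.continuous_leg i).comp (continuous_projIcc.comp continuous_neg))
      ((h.continuous_leg j).comp continuous_projIcc) continuous_id continuous_const ?_
    rintro x rfl
    simp [h.leg_zero]
  have hneg : ∀ s ∈ Icc (-1 : ℝ) 1, s ≤ 0 → ∃ c : I, (c : ℝ) = -s ∧ G s = γ i c := by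
    intro s hs hs0
    have hm : -s ∈ Icc (0 : ℝ) 1 := ⟨by linarith, by linarith [hs.1]⟩
    exact ⟨⟨-s, hm⟩, rfl, by simp only [hGdef, if_pos hs0, projIcc_of_mem _ hm]⟩
  have hpos : ∀ s ∈ Icc (-1 : ℝ) 1, 0 < s → ∃ c : I, (c : ℝ) = s ∧ G s = γ j c := by
    intro s hs hs0
    have hm : s ∈ Icc (0 : ℝ) 1 := ⟨hs0.le, hs.2⟩
    exact ⟨⟨s, hm⟩, rfl, by simp only [hGdef, if_neg (not_le.2 hs0), projIcc_of_mem _ hm]⟩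
  have hmix : ∀ s ∈ Icc (-1 : ℝ) 1, ∀ t ∈ Icc (-1 : ℝ) 1, s ≤ 0 → 0 < t → G s ≠ G t := by
    intro s hs t ht hs0 ht0 hst
    obtain ⟨c, hc, hc'⟩ := hneg s hs hs0
    obtain ⟨d, hd, hd'⟩ := hpos t ht ht0
    have hd0 : d ≠ 0 := by
      rintro rfl
      exact ht0.ne hd
    rw [hc', hd'] at hst
    exact hij (h.eq_of_meet i j c d hst (hst ▸ h.leg_ne_of_ne_zero hd0))
  have hGi : InjOn G (Icc (-1) 1) := by
    intro s hs t ht hst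
    rcases le_or_gt s 0 with hs0 | hs0 <;> rcases le_or_gt t 0 with ht0 | ht0
    · obtain ⟨c, hc, hc'⟩ := hneg s hs hs0
      obtain ⟨d, hd, hd'⟩ := hneg t ht ht0
      rw [hc', hd'] at hst
      have := h.injective_leg i hst
      subst this
      linarith
    · exact absurd hst (hmix s hs t ht hs0 ht0)
    · exact absurd hst.symm (hmix t ht s hs ht0 hs0)
    · obtain ⟨c, hc, hc'⟩ := hpos s hs hs0
      obtain ⟨d, hd, hd'⟩ := hpos t ht ht0
      rw [hc', hd'] at hst
      have := h.injective_leg j hst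
      subst this
      linarith
  by_cases hb0 : b = 0
  · subst hb0
    rw [h.leg_zero, ← h.leg_zero i] at hxy ⊢
    exact aux i a 0 hxy
  have ha := hneg (-a) ⟨by linarith [a.2.2], by linarith [a.2.1]⟩ (by linarith [a.2.1])
  have hb0' : (0 : ℝ) < b := lt_of_le_of_ne b.2.1 fun h' => hb0 (Subtype.ext h'.symm)
  have hb := hpos b ⟨by linarith, b.2.2⟩ hb0'
  obtain ⟨c, hc, hc'⟩ := ha
  obtain ⟨d, hd, hd'⟩ := hb
  have hca : c = a := Subtype.ext (by rw [hc, neg_neg])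
  have hdb : d = b := Subtype.ext hd
  rw [← hca, ← hdb, ← hc', ← hd']
  exact exists_arc_of_injOn hG hGi ⟨by linarith [a.2.2], by linarith [a.2.1]⟩
    ⟨by linarith, b.2.2⟩ (by linarith [a.2.1])

end IsLegSystem

namespace IsLegSystem

variable {X ι : Type} [TopologicalSpace X] {v : X} {γ : ι → I → X}

/-- Two curves issuing from a point of a leg other than `v` and meeting only there leave it in
different directions. -/
lemma lt_iff_lt_of_inter (h : IsLegSystem v γ) {i : ι} {c : I}
    {A B : Set X} (hAB : ∀ x, x ∈ A → x ∈ B → x = γ i c) {d e : I}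
    (hd : γ i '' uIcc c d ⊆ A) (he : γ i '' uIcc c e ⊆ B) (hdc : d ≠ c) (hec : e ≠ c) :
    c < d ↔ e < c := by
  have aux : ∀ w, w ∈ uIcc c d → w ∈ uIcc c e → w = c := fun w h1 h2 =>
    h.injective_leg i (hAB _ (hd ⟨w, h1, rfl⟩) (he ⟨w, h2, rfl⟩))
  rcases lt_or_gt_of_ne hdc with h1 | h1 <;> rcases lt_or_gt_of_ne hec with h2 | h2
  · exfalso
    have := aux (max d e) (by rw [mem_uIcc]; grind) (by rw [mem_uIcc]; grind)
    grind
  · grind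
  · grind
  · exfalso
    have := aux (min d e) (by rw [mem_uIcc]; grind) (by rw [mem_uIcc]; grind)
    grind

variable [T2Space X]

/-- A curve starting at a point of a leg other than `v` covers a one-sided neighbourhood of that
point in the leg. -/
lemma exists_uIcc_subset (h : IsLegSystem v γ) {α : I → X} (hα : Continuous α)
    (hi : Function.Injective α) {i : ι} {c : I} (h0 : α 0 = γ i c) (hc : γ i c ≠ v) :
    ∃ d, d ≠ c ∧ γ i '' uIcc c d ⊆ range α := by
  have hn : α ⁻¹' {v}ᶜ ∈ 𝓝 (0 : I) :=
    (isOpen_compl_singleton.preimage hα).mem_nhds (by simpa [h0] using hc)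
  obtain ⟨δ, hδ0, hδ⟩ : ∃ δ : I, δ ≠ 0 ∧ Icc 0 δ ⊆ α ⁻¹' {v}ᶜ := by
    obtain ⟨u, hu, hu'⟩ := exists_Ico_subset_of_mem_nhds hn ⟨1, zero_lt_one⟩
    obtain ⟨δ, h1, h2⟩ := exists_between hu
    exact ⟨δ, h1.ne', (Icc_subset_Ico_right h2).trans hu'⟩
  have hK : IsPreconnected (α '' Icc 0 δ) := isPreconnected_Icc.image _ hα.continuousOn
  have hvK : v ∉ α '' Icc 0 δ := by
    rintro ⟨t, ht, ht'⟩
    exact hδ ht ht'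
  have h0K : γ i c ∈ α '' Icc 0 δ := ⟨0, ⟨le_rfl, δ.2.1⟩, h0⟩
  have hKi := h.subset_leg_of_mem hK hvK h0K
  have hδK : α δ ∈ α '' Icc 0 δ := ⟨δ, ⟨δ.2.1, le_rfl⟩, rfl⟩
  obtain ⟨d, hd⟩ := hKi hδK
  refine ⟨d, ?_, ?_⟩
  · rintro rfl
    exact hδ0 (hi (hd.symm.trans h0.symm))
  · have := (h.ordConnected_preimage_of_subset hK hKi).uIcc_subset (x := c) (y := d) h0K
      (by rwa [mem_preimage, hd])
    exact (image_subset_iff.2 this).trans (image_subset_range _ _)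

lemma eq_of_isRamificationPoint (h : IsLegSystem v γ) {x : X} (hx : IsRamificationPoint x) :
    x = v := by
  by_contra hxv
  obtain ⟨T, e, he⟩ := hx
  obtain ⟨i, c, rfl⟩ := h.exists_leg x
  have key : ∀ β : I → ℝ × ℝ, Continuous β → Function.Injective β → β 0 = (0, 0) →
      (∀ t, β t ∈ TSet) → ∃ d, d ≠ c ∧ γ i '' uIcc c d ⊆ {x | ∃ t s, x = e t ∧ t = β s} := by
    intro β hβ hβi hβ0 hβT
    obtain ⟨d, hd, hd'⟩ := h.exists_uIcc_subset (α := fun t => (e ⟨β t, hβT t⟩ : X)) (i := i)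
      (c := c) (by fun_prop) (by
        intro s t hst
        have := e.injective (Subtype.ext hst)
        exact hβi (congrArg Subtype.val this)) (by
        rw [← he]
        simp only [hβ0]) hxv
    refine ⟨d, hd, hd'.trans ?_⟩
    rintro _ ⟨t, rfl⟩
    exact ⟨_, t, rfl, rfl⟩
  have meet : ∀ β β' : I → ℝ × ℝ, (∀ s t, β s = β' t → β s = (0, 0)) →
      ∀ x, x ∈ {x | ∃ t s, x = (e t : X) ∧ t = β s} → x ∈ {x | ∃ t s, x = (e t : X) ∧ t = β' s} →
        x = γ i c := by
    rintro β β' hb x ⟨t, s, rfl, hts⟩ ⟨t', s', h1, hts'⟩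
    have : t = t' := e.injective (Subtype.ext h1)
    subst this
    rw [← he]
    congr 2
    exact Subtype.ext (hts.trans (hb s s' (hts ▸ hts')))
  obtain ⟨d₁, hd₁, hd₁'⟩ := key (fun t => ((t : ℝ), 0)) (by fun_prop)
    (fun s t hst => Subtype.ext (congrArg Prod.fst hst)) (by simp)
    (fun t => Or.inl ⟨⟨by linarith [t.2.1], t.2.2⟩, rfl⟩)
  obtain ⟨d₂, hd₂, hd₂'⟩ := key (fun t => (-(t : ℝ), 0)) (by fun_prop)
    (fun s t hst => Subtype.ext (neg_injective (congrArg Prod.fst hst))) (by simp)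
    (fun t => Or.inl ⟨⟨by linarith [t.2.2], by linarith [t.2.1]⟩, rfl⟩)
  obtain ⟨d₃, hd₃, hd₃'⟩ := key (fun t => (0, (t : ℝ))) (by fun_prop)
    (fun s t hst => Subtype.ext (congrArg Prod.snd hst)) (by simp)
    (fun t => Or.inr ⟨rfl, t.2⟩)
  have h12 := h.lt_iff_lt_of_inter (meet _ _ (by
    intro s t hst
    simp only [Prod.mk.injEq, and_true] at hst ⊢
    linarith [s.2.1, t.2.1])) hd₁' hd₂' hd₁ hd₂
  have h13 := h.lt_iff_lt_of_inter (meet _ _ (by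
    intro s t hst
    rw [Prod.mk.injEq] at hst ⊢
    exact ⟨hst.1, rfl⟩)) hd₁' hd₃' hd₁ hd₃
  have h23 := h.lt_iff_lt_of_inter (meet _ _ (by
    intro s t hst
    rw [Prod.mk.injEq] at hst ⊢
    exact ⟨hst.1, rfl⟩)) hd₂' hd₃' hd₂ hd₃
  grind

lemma leg_one_mem_dendroidEndpoints (h : IsLegSystem v γ) (i : ι) :
    γ i 1 ∈ DendroidEndpoints X := by
  rintro A ⟨e⟩ hA
  obtain ⟨t, ht⟩ := e.surjective ⟨_, hA⟩
  have ht' : (e t : X) = γ i 1 := congrArg Subtype.val ht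
  by_cases ht0 : t = 0
  · subst ht0
    exact ⟨e, ht'⟩
  by_cases ht1 : t = 1
  · subst ht1
    rw [← ht']
    exact IsArcEndpoint.of_homeomorph_one e
  exfalso
  have ht0 : (0 : ℝ) < t := lt_of_le_of_ne t.2.1 fun h' => ht0 (Subtype.ext h'.symm)
  have ht1 : (t : ℝ) < 1 := lt_of_le_of_ne t.2.2 fun h' => ht1 (Subtype.ext h')
  have hv : γ i 1 ≠ v := h.leg_ne_of_ne_zero one_ne_zero
  have key : ∀ β : I → ℝ, Continuous β → Function.Injective β → β 0 = t →
      (∀ s, β s ∈ Icc (0 : ℝ) 1) →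
      ∃ d, d ≠ 1 ∧ γ i '' uIcc 1 d ⊆ {x | ∃ t s, x = (e t : X) ∧ (t : ℝ) = β s} := by
    intro β hβ hβi hβ0 hβT
    obtain ⟨d, hd, hd'⟩ := h.exists_uIcc_subset (α := fun s => (e ⟨β s, hβT s⟩ : X)) (i := i)
      (c := 1) (by fun_prop) (by
        intro s t hst
        have := e.injective (Subtype.ext hst)
        exact hβi (congrArg Subtype.val this)) (by
        rw [← ht']
        simp only [hβ0]) hv
    refine ⟨d, hd, hd'.trans ?_⟩
    rintro _ ⟨s, rfl⟩
    exact ⟨_, s, rfl, rfl⟩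
  obtain ⟨d, hd, hd'⟩ := key (fun s => t + s * (1 - t)) (by fun_prop)
    (fun s s' hs => by
      have h1 : (s : ℝ) * (1 - t) = s' * (1 - t) := by simpa using hs
      exact Subtype.ext (mul_right_cancel₀ (by linarith) h1)) (by simp)
    (fun s => ⟨by nlinarith [s.2.1], by nlinarith [s.2.2]⟩)
  obtain ⟨d', hd1, hd1'⟩ := key (fun s => t - s * t) (by fun_prop)
    (fun s s' hs => by
      have h1 : (s : ℝ) * t = s' * t := by simpa using hs
      exact Subtype.ext (mul_right_cancel₀ ht0.ne' h1)) (by simp)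
    (fun s => ⟨by nlinarith [s.2.2], by nlinarith [s.2.1]⟩)
  have := h.lt_iff_lt_of_inter (by
    rintro x ⟨r, s, rfl, hrs⟩ ⟨r', s', h1, hrs'⟩
    have hr : r = r' := e.injective (Subtype.ext h1)
    subst hr
    rw [← ht']
    congr 2
    refine Subtype.ext ?_
    nlinarith [s.2.1, s'.2.1, mul_nonneg s.2.1 (sub_nonneg.2 ht1.le), mul_nonneg s'.2.1 ht0.le])
    hd' hd1' hd hd1
  have h1 : d' < 1 := lt_of_le_of_ne d'.2.2 hd1
  exact absurd (this.2 h1) (not_lt.2 d.2.2)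

lemma isFan [CompactSpace X] [TopologicalSpace.MetrizableSpace X] (h : IsLegSystem v γ) :
    IsFan X := by
  have : Nonempty X := ⟨v⟩
  have : PreconnectedSpace X := ⟨h.isPreconnected_univ⟩
  refine ⟨⟨⟨v⟩, inferInstance, ⟨⟨v⟩⟩, inferInstance, fun x y hxy => h.exists_arc hxy,
    h.hereditarilyUnicoherent⟩, fun x y hx hy => ?_⟩
  rw [h.eq_of_isRamificationPoint hx, h.eq_of_isRamificationPoint hy]

end IsLegSystem

/-- The point `x` separates three points pairwise. -/
def SeparatesThreePoints {X : Type} [TopologicalSpace X] (x : X) : Prop :=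
  ∃ p : Fin 3 → X, (∀ k, p k ≠ x) ∧
    ∀ k l, k ≠ l → ∀ C : Set X, IsPreconnected C → p k ∈ C → p l ∈ C → x ∈ C

lemma SeparatesThreePoints.image {X Y : Type} [TopologicalSpace X] [TopologicalSpace Y]
    (e : X ≃ₜ Y) {x : X} (hx : SeparatesThreePoints x) : SeparatesThreePoints (e x) := by
  obtain ⟨p, hp, hp'⟩ := hx
  refine ⟨fun k => e (p k), fun k => by simpa using hp k, fun k l hkl C hC hk hl => ?_⟩
  exact hp' k l hkl (e ⁻¹' C) (e.isPreconnected_preimage.2 hC) hk hl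

namespace IsLegSystem

variable {X ι : Type} [TopologicalSpace X] {v : X} {γ : ι → I → X}

lemma separatesThreePoints (h : IsLegSystem v γ) {j : Fin 3 → ι} (hj : Function.Injective j) :
    SeparatesThreePoints v := by
  refine ⟨fun k => γ (j k) 1, fun k => h.leg_ne_of_ne_zero one_ne_zero,
    fun k l hkl C hC hk hl => ?_⟩
  by_contra hv
  obtain ⟨b, hb⟩ := h.subset_leg_of_mem hC hv hk hl
  exact hkl (hj (h.eq_of_meet _ _ _ _ hb (hb ▸ h.leg_ne_of_ne_zero one_ne_zero)))

lemma eq_of_separatesThreePoints (h : IsLegSystem v γ) {x : X} (hx : SeparatesThreePoints x) :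
    x = v := by
  by_contra hxv
  obtain ⟨p, hp, hp'⟩ := hx
  obtain ⟨i, c, rfl⟩ := h.exists_leg x
  set U : Set X := γ i '' Ioi c
  set L : Set X := ⋃ j, γ j '' {a | ∀ a' ≤ a, γ j a' ≠ γ i c}
  have hU : IsPreconnected U := isPreconnected_Ioi.image _ (h.continuous_leg i).continuousOn
  have hL : IsPreconnected L := by
    refine isPreconnected_iUnion ⟨v, mem_iInter.2 fun j => ⟨0, ?_, h.leg_zero j⟩⟩
      fun j => IsPreconnected.image ?_ _ (h.continuous_leg j).continuousOn
    · intro a' ha'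
      rw [le_antisymm ha' a'.2.1, h.leg_zero]
      exact Ne.symm hxv
    · refine OrdConnected.isPreconnected ⟨fun a _ b hb d hd a' ha' => hb a' (ha'.trans hd.2)⟩
  have hxU : γ i c ∉ U := by
    rintro ⟨a, ha, ha'⟩
    exact (ne_of_gt ha) (h.injective_leg i ha')
  have hxL : γ i c ∉ L := by
    intro hmem
    obtain ⟨j, a, ha, ha'⟩ := mem_iUnion.1 hmem
    exact ha a le_rfl ha'
  have hcov : ∀ y, y ≠ γ i c → y ∈ U ∨ y ∈ L := by
    intro y hy
    obtain ⟨j, a, rfl⟩ := h.exists_leg y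
    by_cases hL' : ∀ a' ≤ a, γ j a' ≠ γ i c
    · exact Or.inr (mem_iUnion.2 ⟨j, a, hL', rfl⟩)
    · push Not at hL'
      obtain ⟨a', ha', he⟩ := hL'
      have hji : j = i := h.eq_of_meet j i a' c he (he ▸ hxv)
      subst hji
      have : a' = c := h.injective_leg j he
      subst this
      exact Or.inl ⟨a, lt_of_le_of_ne ha' fun h' => hy (by rw [h']), rfl⟩
  have hUU : ∀ k l, k ≠ l → ¬ (p k ∈ U ∧ p l ∈ U) := fun k l hkl hh =>
    hxU (hp' k l hkl U hU hh.1 hh.2)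
  have hLL : ∀ k l, k ≠ l → ¬ (p k ∈ L ∧ p l ∈ L) := fun k l hkl hh =>
    hxL (hp' k l hkl L hL hh.1 hh.2)
  have h01 : (0 : Fin 3) ≠ 1 := by decide
  have h02 : (0 : Fin 3) ≠ 2 := by decide
  have h12 : (1 : Fin 3) ≠ 2 := by decide
  have := hUU 0 1 h01
  have := hUU 0 2 h02
  have := hUU 1 2 h12
  have := hLL 0 1 h01
  have := hLL 0 2 h02
  have := hLL 1 2 h12
  have := hcov _ (hp 0)
  have := hcov _ (hp 1)
  have := hcov _ (hp 2)
  tauto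

end IsLegSystem

/-- `z` lies between `v` and `y`: every subcontinuum through `v` and `y` contains `z`. -/
def IsBelow {X : Type} [TopologicalSpace X] (v z y : X) : Prop :=
  ∀ C : Set X, IsSubcontinuum C → v ∈ C → y ∈ C → z ∈ C

/-- The closure of the relation `IsBelow v`. -/
def IsLimitBelow {X : Type} [TopologicalSpace X] (v z y : X) : Prop :=
  (z, y) ∈ closure {p : X × X | IsBelow v p.1 p.2}

/-- Points `y` with a limit predecessor which is not a predecessor. -/
def nonsmoothPoints {X : Type} [TopologicalSpace X] (v : X) : Set X :=
  {y | ∃ z, IsLimitBelow v z y ∧ ¬ IsBelow v z y}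

/-- The largest limit predecessors of the points in `nonsmoothPoints v`. -/
def peakPoints {X : Type} [TopologicalSpace X] (v : X) : Set X :=
  {z | ∃ y, IsLimitBelow v z y ∧ ¬ IsBelow v z y ∧ ∀ z', IsLimitBelow v z' y → IsBelow v z' z}

section Homeomorph

variable {X Y : Type} [TopologicalSpace X] [TopologicalSpace Y] (e : X ≃ₜ Y) (v : X)

lemma isBelow_image_iff (z y : X) : IsBelow (e v) (e z) (e y) ↔ IsBelow v z y := by
  constructor
  · intro h C hC hv hy
    have := h (e '' C) ⟨hC.1.image e.continuous, hC.2.image e e.continuous.continuousOn⟩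
      (mem_image_of_mem e hv) (mem_image_of_mem e hy)
    simpa using this
  · intro h C hC hv hy
    exact h (e ⁻¹' C) ⟨e.isCompact_preimage.2 hC.1, e.isConnected_preimage.2 hC.2⟩ hv hy

lemma isLimitBelow_image_iff (z y : X) :
    IsLimitBelow (e v) (e z) (e y) ↔ IsLimitBelow v z y := by
  have : {p : X × X | IsBelow v p.1 p.2} =
      (e.prodCongr e) ⁻¹' {p : Y × Y | IsBelow (e v) p.1 p.2} := by
    ext p
    exact (isBelow_image_iff e v p.1 p.2).symm
  rw [IsLimitBelow, IsLimitBelow, this, ← (e.prodCongr e).preimage_closure]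
  rfl

lemma mem_nonsmoothPoints_image_iff (y : X) :
    e y ∈ nonsmoothPoints (e v) ↔ y ∈ nonsmoothPoints v := by
  simp only [nonsmoothPoints, mem_ofPred_eq, e.surjective.exists, isLimitBelow_image_iff,
    isBelow_image_iff]

lemma mem_peakPoints_image_iff (z : X) : e z ∈ peakPoints (e v) ↔ z ∈ peakPoints v := by
  simp only [peakPoints, mem_ofPred_eq, e.surjective.exists, e.surjective.forall,
    isLimitBelow_image_iff, isBelow_image_iff]

end Homeomorph

namespace IsLegSystem

variable {X ι : Type} [TopologicalSpace X] {v : X} {γ : ι → I → X} [T2Space X]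

lemma isBelow_leg_iff (h : IsLegSystem v γ) {i : ι} {z : X} {b : I} :
    IsBelow v z (γ i b) ↔ ∃ a ≤ b, γ i a = z := by
  constructor
  · intro hz
    obtain ⟨a, ha, rfl⟩ := hz (γ i '' Icc 0 b)
      ⟨isCompact_Icc.image (h.continuous_leg i), ⟨_, 0, ⟨le_rfl, b.2.1⟩, rfl⟩,
        isPreconnected_Icc.image _ (h.continuous_leg i).continuousOn⟩
      ⟨0, ⟨le_rfl, b.2.1⟩, h.leg_zero i⟩ ⟨b, ⟨b.2.1, le_rfl⟩, rfl⟩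
    exact ⟨a, ha.2, rfl⟩
  · rintro ⟨a, ha, rfl⟩ C hC hv hb
    exact h.mem_of_le hC hv ha hb

end IsLegSystem

section FoldingMap

/-- The points at which the folding map returns to the identity. -/
noncomputable def foldNode (k : ℕ) : ℝ := 1 - (1 / 2) ^ k

/-- The tent supported on `[foldNode k, foldNode (k + 1)]`. -/
noncomputable def foldTent (k : ℕ) (t : ℝ) : ℝ :=
  max 0 (min (t - foldNode k) (foldNode (k + 1) - t))

open Classical in
/-- The amplitude of the `k`-th fold, which encodes whether `k ∈ T`. -/
noncomputable def foldCoeff (T : Set ℕ) (k : ℕ) : ℝ := if k ∈ T then 2 else 3 / 2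

/-- A map of `[0,1]` onto itself with one fold between any two consecutive nodes. -/
noncomputable def foldMap (T : Set ℕ) (t : ℝ) : ℝ := t + ∑' k, foldCoeff T k * foldTent k t

/-- The maximum of the folding map on `[0, foldNode (k + 1)]`. -/
noncomputable def foldPeak (T : Set ℕ) (k : ℕ) : ℝ :=
  foldNode (k + 1) + (foldCoeff T k - 1) * (1 / 2) ^ (k + 2)

/-- The pairs of values taken by the folding map at `t' ≤ t`. -/
def FoldRel (T : Set ℕ) (w u : ℝ) : Prop :=
  ∃ t' t, 0 ≤ t' ∧ t' ≤ t ∧ t ≤ 1 ∧ foldMap T t' = w ∧ foldMap T t = u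

variable (T : Set ℕ)

lemma foldCoeff_mem (k : ℕ) : foldCoeff T k ∈ Icc (3 / 2 : ℝ) 2 := by
  unfold foldCoeff
  split_ifs <;> norm_num

lemma foldNode_succ (k : ℕ) : foldNode (k + 1) = foldNode k + (1 / 2) ^ (k + 1) := by
  unfold foldNode
  ring

lemma foldNode_lt_succ (k : ℕ) : foldNode k < foldNode (k + 1) := by
  rw [foldNode_succ]
  have : (0 : ℝ) < (1 / 2) ^ (k + 1) := by positivity
  linarith

lemma foldNode_strictMono : StrictMono foldNode := strictMono_nat_of_lt_succ foldNode_lt_succ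

lemma foldNode_zero : foldNode 0 = 0 := by simp [foldNode]

lemma foldNode_nonneg (k : ℕ) : 0 ≤ foldNode k := by
  rw [← foldNode_zero]
  exact foldNode_strictMono.monotone (Nat.zero_le k)

lemma foldNode_lt_one (k : ℕ) : foldNode k < 1 := by
  unfold foldNode
  have : (0 : ℝ) < (1 / 2) ^ k := by positivity
  linarith

lemma exists_foldNode_le_lt {t : ℝ} (h0 : 0 ≤ t) (h1 : t < 1) :
    ∃ k, foldNode k ≤ t ∧ t < foldNode (k + 1) := by
  obtain ⟨n, hn, hn'⟩ := exists_nat_pow_near_of_lt_one (x := 1 - t) (y := (1 / 2 : ℝ))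
    (by linarith) (by linarith) (by norm_num) (by norm_num)
  exact ⟨n, by unfold foldNode; linarith, by unfold foldNode; linarith⟩

lemma foldTent_nonneg (k : ℕ) (t : ℝ) : 0 ≤ foldTent k t := le_max_left _ _

lemma foldTent_le (k : ℕ) (t : ℝ) : foldTent k t ≤ (1 / 2) ^ (k + 2) := by
  have h := foldNode_succ k
  refine max_le (by positivity) ?_
  have h2 : (1 / 2 : ℝ) ^ (k + 1) = 2 * (1 / 2) ^ (k + 2) := by ring
  rcases le_total (t - foldNode k) (foldNode (k + 1) - t) with h' | h'
  · rw [min_eq_left h']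
    linarith
  · rw [min_eq_right h']
    linarith

lemma continuous_foldMap : Continuous (foldMap T) := by
  refine continuous_id.add (continuous_tsum (u := fun k => 2 * (1 / 2 : ℝ) ^ (k + 2)) ?_ ?_ ?_)
  · intro k
    unfold foldTent
    fun_prop
  · exact ((summable_nat_add_iff 2).2 summable_geometric_two).mul_left 2
  · intro k t
    have h1 := foldCoeff_mem T k
    rw [Real.norm_of_nonneg (mul_nonneg (by linarith [h1.1]) (foldTent_nonneg k t))]
    exact mul_le_mul h1.2 (foldTent_le k t) (foldTent_nonneg k t) (by norm_num)

lemma foldMap_eq {k : ℕ} {t : ℝ} (h : t ∈ Icc (foldNode k) (foldNode (k + 1))) :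
    foldMap T t = t + foldCoeff T k * min (t - foldNode k) (foldNode (k + 1) - t) := by
  unfold foldMap
  rw [tsum_eq_single k, foldTent, max_eq_right]
  · exact le_min (by linarith [h.1]) (by linarith [h.2])
  · intro j hj
    have : foldTent j t = 0 := by
      refine max_eq_left ?_
      rcases lt_or_gt_of_ne hj with hj | hj
      · refine (min_le_right _ _).trans ?_
        have := foldNode_strictMono.monotone (Nat.succ_le_of_lt hj)
        simp only [Nat.succ_eq_add_one] at this
        linarith [h.1]
      · refine (min_le_left _ _).trans ?_
        have := foldNode_strictMono.monotone (Nat.succ_le_of_lt hj)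
        simp only [Nat.succ_eq_add_one] at this
        linarith [h.2]
    rw [this, mul_zero]

lemma foldMap_node (k : ℕ) : foldMap T (foldNode k) = foldNode k := by
  rw [foldMap_eq T (k := k) ⟨le_rfl, (foldNode_lt_succ k).le⟩, sub_self,
    min_eq_left (by linarith [foldNode_lt_succ k])]
  ring

lemma foldMap_zero : foldMap T 0 = 0 := by
  simpa [foldNode_zero] using foldMap_node T 0

lemma foldMap_one : foldMap T 1 = 1 := by
  have : ∀ k, foldTent k 1 = 0 := fun k =>
    max_eq_left ((min_le_right _ _).trans (by linarith [foldNode_lt_one (k + 1)]))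
  simp [foldMap, this]

lemma le_foldMap (t : ℝ) : t ≤ foldMap T t := by
  have : 0 ≤ ∑' k, foldCoeff T k * foldTent k t := tsum_nonneg fun k =>
    mul_nonneg (by linarith [(foldCoeff_mem T k).1]) (foldTent_nonneg k t)
  unfold foldMap
  linarith

lemma foldNode_lt_foldPeak (k : ℕ) : foldNode (k + 1) < foldPeak T k := by
  unfold foldPeak
  have h1 := (foldCoeff_mem T k).1
  have : (0 : ℝ) < (1 / 2) ^ (k + 2) := by positivity
  nlinarith

lemma foldPeak_le_foldNode (k : ℕ) : foldPeak T k ≤ foldNode (k + 2) := by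
  rw [foldPeak, foldNode_succ (k + 1)]
  have h1 := (foldCoeff_mem T k).2
  have : (0 : ℝ) < (1 / 2) ^ (k + 2) := by positivity
  nlinarith

lemma foldPeak_eq_foldNode {k : ℕ} (hk : k ∈ T) : foldPeak T k = foldNode (k + 2) := by
  rw [foldPeak, foldNode_succ (k + 1), foldCoeff, if_pos hk]
  ring

lemma foldPeak_lt_foldNode {k : ℕ} (hk : k ∉ T) : foldPeak T k < foldNode (k + 2) := by
  rw [foldPeak, foldNode_succ (k + 1), foldCoeff, if_neg hk]
  have : (0 : ℝ) < (1 / 2) ^ (k + 2) := by positivity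
  linarith

lemma foldPeak_strictMono : StrictMono (foldPeak T) := strictMono_nat_of_lt_succ fun k =>
  (foldPeak_le_foldNode T k).trans_lt (foldNode_lt_foldPeak T (k + 1))

lemma foldPeak_mem_Icc (k : ℕ) : foldPeak T k ∈ Icc (0 : ℝ) 1 :=
  ⟨(foldNode_nonneg _).trans (foldNode_lt_foldPeak T k).le,
    (foldPeak_le_foldNode T k).trans (foldNode_lt_one _).le⟩

/-- The point at which the `k`-th peak is attained. -/
lemma exists_foldMap_eq_foldPeak (k : ℕ) :
    foldMap T (foldNode k + (1 / 2) ^ (k + 2)) = foldPeak T k := by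
  have h := foldNode_succ k
  have h2 : (1 / 2 : ℝ) ^ (k + 1) = 2 * (1 / 2) ^ (k + 2) := by ring
  have : (0 : ℝ) < (1 / 2) ^ (k + 2) := by positivity
  rw [foldMap_eq T (k := k) ⟨by linarith, by linarith⟩, foldPeak, min_eq_left (by linarith)]
  linarith

lemma foldMap_le_foldPeak_of_mem {k : ℕ} {t : ℝ}
    (h : t ∈ Icc (foldNode k) (foldNode (k + 1))) : foldMap T t ≤ foldPeak T k := by
  have h1 := foldNode_succ k
  have h2 : (1 / 2 : ℝ) ^ (k + 1) = 2 * (1 / 2) ^ (k + 2) := by ring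
  have hc := foldCoeff_mem T k
  rw [foldMap_eq T h, foldPeak]
  rcases le_total (t - foldNode k) (foldNode (k + 1) - t) with h' | h'
  · rw [min_eq_left h']
    nlinarith [hc.1]
  · rw [min_eq_right h']
    nlinarith [hc.1]

lemma foldMap_le_foldPeak {k : ℕ} {t : ℝ} (h0 : 0 ≤ t) (h : t ≤ foldNode (k + 1)) :
    foldMap T t ≤ foldPeak T k := by
  rcases h.eq_or_lt with rfl | h
  · rw [foldMap_node]
    exact (foldNode_lt_foldPeak T k).le
  obtain ⟨j, hj, hj'⟩ := exists_foldNode_le_lt h0 (h.trans (foldNode_lt_one _))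
  have hjk : j ≤ k := Nat.lt_succ_iff.1 (foldNode_strictMono.lt_iff_lt.1 (hj.trans_lt h))
  exact (foldMap_le_foldPeak_of_mem T ⟨hj, hj'.le⟩).trans ((foldPeak_strictMono T).monotone hjk)

/-- On a fold, a later smaller value is attained past the peak, on the descending part. -/
lemma descending_of_foldMap_lt {k : ℕ} {s t : ℝ} (hs : foldNode k ≤ s) (hst : s ≤ t)
    (ht : t ≤ foldNode (k + 1)) (h : foldMap T t < foldMap T s) :
    foldNode k + (1 / 2) ^ (k + 2) ≤ t ∧ foldNode (k + 1) ≤ foldMap T t := by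
  have h1 := foldNode_succ k
  have h2 : (1 / 2 : ℝ) ^ (k + 1) = 2 * (1 / 2) ^ (k + 2) := by ring
  have hc := foldCoeff_mem T k
  rw [foldMap_eq T ⟨hs.trans hst, ht⟩, foldMap_eq T ⟨hs, hst.trans ht⟩] at h
  rw [foldMap_eq T ⟨hs.trans hst, ht⟩]
  rcases le_total (t - foldNode k) (foldNode (k + 1) - t) with h' | h'
  · rw [min_eq_left h', min_eq_left (by linarith)] at h
    nlinarith [hc.1]
  · rw [min_eq_right h']
    exact ⟨by linarith, by nlinarith [hc.1]⟩

lemma foldMap_le_one {t : ℝ} (h0 : 0 ≤ t) (h1 : t ≤ 1) : foldMap T t ≤ 1 := by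
  rcases h1.eq_or_lt with rfl | h1
  · exact (foldMap_one T).le
  · obtain ⟨k, hk, hk'⟩ := exists_foldNode_le_lt h0 h1
    exact (foldMap_le_foldPeak_of_mem T ⟨hk, hk'.le⟩).trans (foldPeak_mem_Icc T k).2

lemma foldMap_mem_Icc {t : ℝ} (h : t ∈ Icc (0 : ℝ) 1) : foldMap T t ∈ Icc (0 : ℝ) 1 :=
  ⟨h.1.trans (le_foldMap T t), foldMap_le_one T h.1 h.2⟩

lemma exists_foldMap_eq {s u : ℝ} (hs : s ∈ Icc (0 : ℝ) 1) (hu : u ∈ Icc 0 (foldMap T s)) :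
    ∃ t ∈ Icc 0 s, foldMap T t = u :=
  intermediate_value_Icc hs.1 (continuous_foldMap T).continuousOn (by rwa [foldMap_zero])

/-- The peaks are the largest values preceding a smaller value. -/
lemma exists_isGreatest_foldRel_iff (w : ℝ) :
    (∃ u, FoldRel T w u ∧ u < w ∧ ∀ w', FoldRel T w' u → w' ≤ w) ↔ w ∈ range (foldPeak T) := by
  constructor
  · rintro ⟨u, ⟨t', t, h0, htt, ht, rfl, rfl⟩, hlt, hmax⟩
    have ht1 : t < 1 := by
      refine lt_of_le_of_ne ht ?_
      rintro rfl
      rw [foldMap_one] at hlt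
      exact absurd hlt (not_lt.2 (foldMap_le_one T h0 htt))
    obtain ⟨j, hj, hj'⟩ := exists_foldNode_le_lt (h0.trans htt) ht1
    rcases le_or_gt (foldNode j) t' with h' | h'
    · refine ⟨j, le_antisymm ?_ (foldMap_le_foldPeak_of_mem T ⟨h', htt.trans hj'.le⟩)⟩
      refine hmax _ ⟨_, t, ?_, (descending_of_foldMap_lt T h' htt hj'.le hlt).1, ht,
        exists_foldMap_eq_foldPeak T j, rfl⟩
      have := foldNode_nonneg j
      positivity
    · cases j with
      | zero => exact absurd h' (not_lt.2 (by rwa [foldNode_zero]))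
      | succ j =>
        refine ⟨j, le_antisymm ?_ (foldMap_le_foldPeak T h0 h'.le)⟩
        have hp : (0 : ℝ) < (1 / 2) ^ (j + 2) := by positivity
        have h2 : (1 / 2 : ℝ) ^ (j + 1) = 2 * (1 / 2) ^ (j + 2) := by ring
        refine hmax _ ⟨_, t, ?_, ?_, ht, exists_foldMap_eq_foldPeak T j, rfl⟩
        · linarith [foldNode_nonneg j]
        · linarith [foldNode_succ j]
  · rintro ⟨k, rfl⟩
    have hp : (0 : ℝ) < (1 / 2) ^ (k + 2) := by positivity
    have h2 : (1 / 2 : ℝ) ^ (k + 1) = 2 * (1 / 2) ^ (k + 2) := by ring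
    refine ⟨foldNode (k + 1), ⟨_, foldNode (k + 1), ?_, ?_, (foldNode_lt_one _).le,
      exists_foldMap_eq_foldPeak T k, foldMap_node T _⟩, foldNode_lt_foldPeak T k, ?_⟩
    · linarith [foldNode_nonneg k]
    · linarith [foldNode_succ k]
    · rintro _ ⟨t', t, h0, htt, ht, rfl, hu⟩
      exact foldMap_le_foldPeak T h0 (htt.trans ((le_foldMap T t).trans hu.le))

lemma exists_foldRel_foldPeak_iff (k : ℕ) :
    (∃ w, FoldRel T w (foldPeak T k) ∧ foldPeak T k < w) ↔ k ∈ T := by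
  constructor
  · rintro ⟨_, ⟨t', t, h0, htt, ht, rfl, hu⟩, hlt⟩
    by_contra hk
    have h1 : foldNode (k + 1) ≤ t' := by
      by_contra h1
      exact absurd hlt (not_lt.2 (foldMap_le_foldPeak T h0 (not_le.1 h1).le))
    have h2 : t < foldNode (k + 2) :=
      ((le_foldMap T t).trans hu.le).trans_lt (foldPeak_lt_foldNode T hk)
    have := (descending_of_foldMap_lt T h1 htt h2.le (hu ▸ hlt)).2
    rw [hu] at this
    exact absurd (foldPeak_lt_foldNode T hk) (not_lt.2 this)
  · intro hk
    have hp : (0 : ℝ) < (1 / 2) ^ (k + 3) := by positivity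
    have h2 : (1 / 2 : ℝ) ^ (k + 2) = 2 * (1 / 2) ^ (k + 3) := by ring
    refine ⟨foldPeak T (k + 1), ⟨_, foldNode (k + 2), ?_, ?_, (foldNode_lt_one _).le,
      exists_foldMap_eq_foldPeak T (k + 1), ?_⟩, foldPeak_strictMono T (Nat.lt_succ_self k)⟩
    · have := foldNode_nonneg (k + 1)
      positivity
    · linarith [foldNode_succ (k + 1)]
    · rw [foldMap_node, foldPeak_eq_foldNode T hk]

end FoldingMap

section SlopeSpace

/-- The slopes allowed in `slopeSpace`. -/
def slopes : Set ℝ := {1 / 2} ∪ insert 1 (range fun n : ℕ => 1 + 1 / ((n : ℝ) + 1))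

/-- The sequences in `[0,1]` all of whose consecutive ratios are allowed slopes. -/
def slopeSpace : Set (ℕ → ℝ) :=
  {x | ∀ n, x n ∈ Icc (0 : ℝ) 1 ∧ ∃ c ∈ slopes, x (n + 1) = c * x n}

/-- The sequence `x` preceded by `a`. -/
def seqCons (a : ℝ) (x : ℕ → ℝ) : ℕ → ℝ
  | 0 => a
  | n + 1 => x n

lemma isCompact_slopes : IsCompact slopes := by
  refine isCompact_singleton.union (Tendsto.isCompact_insert_range ?_)
  simpa using (tendsto_one_div_add_atTop_nhds_zero_nat (𝕜 := ℝ)).const_add 1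

lemma half_mem_slopes : (1 / 2 : ℝ) ∈ slopes := Or.inl rfl

lemma one_mem_slopes : (1 : ℝ) ∈ slopes := Or.inr (Or.inl rfl)

lemma one_add_mem_slopes (n : ℕ) : 1 + 1 / ((n : ℝ) + 1) ∈ slopes := Or.inr (Or.inr ⟨n, rfl⟩)

lemma slopes_pos {c : ℝ} (hc : c ∈ slopes) : 0 < c := by
  rcases hc with rfl | rfl | ⟨n, rfl⟩ <;> positivity

lemma not_irrational_of_mem_slopes {c : ℝ} (hc : c ∈ slopes) : ¬ Irrational c := by
  rw [Irrational, not_not]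
  rcases hc with rfl | rfl | ⟨n, rfl⟩
  · exact ⟨1 / 2, by norm_num⟩
  · exact ⟨1, by norm_num⟩
  · exact ⟨1 + 1 / ((n : ℚ) + 1), by push_cast; rfl⟩

lemma isCompact_slopeSpace : IsCompact slopeSpace := by
  have hG : IsClosed ((fun p : ℝ × ℝ => (p.2, p.1 * p.2)) '' slopes ×ˢ Icc (0 : ℝ) 1) :=
    ((isCompact_slopes.prod isCompact_Icc).image (by fun_prop)).isClosed
  refine (isCompact_univ_pi fun _ : ℕ => isCompact_Icc (a := (0 : ℝ)) (b := 1)).of_isClosed_subset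
    (?_ : IsClosed slopeSpace) fun x hx n _ => (hx n).1
  have : slopeSpace = ⋂ n, (fun x : ℕ → ℝ => (x n, x (n + 1))) ⁻¹'
      ((fun p : ℝ × ℝ => (p.2, p.1 * p.2)) '' slopes ×ˢ Icc (0 : ℝ) 1) := by
    ext x
    rw [mem_iInter]
    refine forall_congr' fun n => ?_
    constructor
    · rintro ⟨h1, c, hc, h2⟩
      exact ⟨(c, x n), ⟨hc, h1⟩, by simp [h2]⟩
    · rintro ⟨⟨c, t⟩, ⟨hc, ht⟩, h⟩
      simp only [Prod.mk.injEq] at h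
      obtain ⟨rfl, h⟩ := h
      exact ⟨ht, c, hc, h.symm⟩
  rw [this]
  exact isClosed_iInter fun n => hG.preimage (by fun_prop)

variable {x y : ℕ → ℝ}

lemma smul_mem_slopeSpace (hx : x ∈ slopeSpace) {r : ℝ} (hr : 0 ≤ r) (h : ∀ n, r * x n ≤ 1) :
    r • x ∈ slopeSpace := by
  intro n
  obtain ⟨h1, c, hc, h2⟩ := hx n
  refine ⟨⟨mul_nonneg hr h1.1, h n⟩, c, hc, ?_⟩
  simp only [Pi.smul_apply, smul_eq_mul, h2]
  ring

lemma smul_mem_slopeSpace_of_mem_Icc (hx : x ∈ slopeSpace) {r : ℝ} (hr : r ∈ Icc (0 : ℝ) 1) :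
    r • x ∈ slopeSpace :=
  smul_mem_slopeSpace hx hr.1 fun n => mul_le_one₀ hr.2 (hx n).1.1 (hx n).1.2

lemma seqCons_mem_slopeSpace (hx : x ∈ slopeSpace) {a c : ℝ} (ha : a ∈ Icc (0 : ℝ) 1)
    (hc : c ∈ slopes) (h : x 0 = c * a) : seqCons a x ∈ slopeSpace := by
  intro n
  cases n with
  | zero => exact ⟨ha, c, hc, h⟩
  | succ n => exact hx n

lemma shift_mem_slopeSpace (hx : x ∈ slopeSpace) : (fun n => x (n + 1)) ∈ slopeSpace :=
  fun n => hx (n + 1)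

lemma const_mem_slopeSpace {t : ℝ} (ht : t ∈ Icc (0 : ℝ) 1) : (fun _ => t) ∈ slopeSpace :=
  fun _ => ⟨ht, 1, one_mem_slopes, (one_mul t).symm⟩

lemma eq_zero_of_zero_eq_zero (hx : x ∈ slopeSpace) (h : x 0 = 0) : x = 0 := by
  funext n
  induction n with
  | zero => exact h
  | succ n ih =>
    obtain ⟨-, c, -, h2⟩ := hx n
    rw [h2, ih]
    simp

lemma pos_of_zero_pos (hx : x ∈ slopeSpace) (h : 0 < x 0) (n : ℕ) : 0 < x n := by
  induction n with
  | zero => exact h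
  | succ n ih =>
    obtain ⟨-, c, hc, h2⟩ := hx n
    rw [h2]
    exact mul_pos (slopes_pos hc) ih

lemma glue_mem_slopeSpace (hx : x ∈ slopeSpace) (hy : y ∈ slopeSpace) {N : ℕ} (h : y 0 = x N) :
    (fun i => if i < N then x i else y (i - N)) ∈ slopeSpace := by
  intro n
  simp only
  rcases lt_trichotomy (n + 1) N with h1 | h1 | h1
  · rw [if_pos (by omega), if_pos h1]
    exact hx n
  · rw [if_pos (by omega), if_neg (by omega), h1, Nat.sub_self, h, ← h1]
    exact hx n
  · rw [if_neg (by omega), if_neg (by omega), Nat.sub_add_comm (by omega)]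
    exact hy (n - N)

/-- Prolonging a sequence to the left with constant slope. -/
lemma exists_prolongation {c : ℝ} (hc : c ∈ slopes) (m : ℕ) (hy : y ∈ slopeSpace) {a : ℝ}
    (ha : a ∈ Icc (0 : ℝ) 1) (h : y 0 = c ^ m * a) :
    ∃ z ∈ slopeSpace, z 0 = a ∧ (∀ i, z (m + i) = y i) ∧ ∀ i ≤ m, z i = c ^ i * a := by
  induction m generalizing a with
  | zero => exact ⟨y, hy, by simpa using h, by simp, fun i hi => by
      obtain rfl : i = 0 := by omega
      exact h⟩
  | succ m ih =>
    have hc0 := slopes_pos hc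
    have hca : c * a ∈ Icc (0 : ℝ) 1 := by
      refine ⟨mul_nonneg hc0.le ha.1, ?_⟩
      rcases le_total c 1 with h1 | h1
      · exact mul_le_one₀ h1 ha.1 ha.2
      · calc c * a ≤ c ^ m * (c * a) :=
              le_mul_of_one_le_left (mul_nonneg hc0.le ha.1) (one_le_pow₀ h1)
          _ = y 0 := by rw [h]; ring
          _ ≤ 1 := (hy 0).1.2
    obtain ⟨z, hz, h0, h1, h2⟩ := ih hca (by rw [h]; ring)
    refine ⟨seqCons a z, seqCons_mem_slopeSpace hz ha hc h0, rfl, fun i => ?_, fun i hi => ?_⟩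
    · rw [← h1 i, show m + 1 + i = (m + i) + 1 by ring]
      rfl
    · cases i with
      | zero => simp [seqCons]
      | succ i =>
        change z i = _
        rw [h2 i (by omega)]
        ring

lemma exists_connection {a b ε : ℝ} (ha : a ∈ Ioc (0 : ℝ) 1) (hb : b ∈ Ioc (0 : ℝ) 1)
    (hε : 0 < ε) :
    ∃ m₀ : ℕ, ∃ ρ ∈ Ioc (0 : ℝ) 1, 1 - ε < ρ ∧ ∀ y ∈ slopeSpace, y 0 = ρ * b → ∀ m ≥ m₀,
      ∃ z ∈ slopeSpace, z 0 = a ∧ ∀ i, z (m + i) = y i := by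
  obtain ⟨N, hN⟩ := exists_nat_one_div_lt hε
  set δ : ℝ := 1 / ((N : ℝ) + 1) with hδ
  have hδ0 : 0 < δ := by positivity
  obtain ⟨j, hj⟩ := exists_pow_lt_of_lt_one hb.1 (by norm_num : (1 / 2 : ℝ) < 1)
  have hja0 : 0 < (1 / 2 : ℝ) ^ j * a := mul_pos (by positivity) ha.1
  have hjab : (1 / 2 : ℝ) ^ j * a ≤ b :=
    (mul_le_of_le_one_right (by positivity) ha.2).trans hj.le
  obtain ⟨k, hk, hk'⟩ := exists_nat_pow_near ((one_le_div hja0).2 hjab)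
    (by linarith : 1 < 1 + δ)
  rw [le_div_iff₀ hja0] at hk
  rw [div_lt_iff₀ hja0, pow_succ] at hk'
  have hck : 0 < (1 + δ) ^ k := by positivity
  have hρ0 : 0 < (1 + δ) ^ k * ((1 / 2) ^ j * a) / b := div_pos (mul_pos hck hja0) hb.1
  refine ⟨j + k, (1 + δ) ^ k * ((1 / 2) ^ j * a) / b, ⟨hρ0, (div_le_one hb.1).2 hk⟩, ?_, ?_⟩
  · rw [lt_div_iff₀ hb.1]
    set w := (1 + δ) ^ k * ((1 / 2) ^ j * a)
    have h1 : b < (1 + δ) * w := by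
      calc b < (1 + δ) ^ k * (1 + δ) * ((1 / 2) ^ j * a) := hk'
        _ = (1 + δ) * w := by ring
    have hw : 0 < w := mul_pos hck hja0
    nlinarith [mul_pos hδ0 hw, hb.1]
  · intro y hy hy0 m hm
    rw [div_mul_cancel₀ _ hb.1.ne'] at hy0
    obtain ⟨l, rfl⟩ := Nat.exists_eq_add_of_le hm
    obtain ⟨z₁, hz₁, h1, h1', -⟩ := exists_prolongation one_mem_slopes l hy (hy 0).1 (by simp)
    obtain ⟨z₂, hz₂, h2, h2', -⟩ := exists_prolongation (one_add_mem_slopes N) k hz₁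
      (a := (1 / 2) ^ j * a) ⟨hja0.le, hjab.trans hb.2⟩ (h1.trans hy0)
    obtain ⟨z₃, hz₃, h3, h3', -⟩ := exists_prolongation half_mem_slopes j hz₂
      (a := a) ⟨ha.1.le, ha.2⟩ h2
    refine ⟨z₃, hz₃, h3, fun i => ?_⟩
    rw [add_assoc, add_assoc, h3', h2', h1']

lemma exists_cylinder_subset {U : Set (ℕ → ℝ)} (hU : IsOpen U) (hx : x ∈ U) :
    ∃ N, ∀ y : ℕ → ℝ, (∀ i ≤ N, y i = x i) → y ∈ U := by
  obtain ⟨F, u, hu, hs⟩ := isOpen_pi_iff.1 hU x hx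
  refine ⟨F.sup id, fun y hy => hs fun i hi => ?_⟩
  rw [hy i (Finset.le_sup (f := id) hi)]
  exact (hu i hi).2

lemma exists_smul_mem {U : Set (ℕ → ℝ)} (hU : IsOpen U) (hx : x ∈ U) :
    ∃ ε > 0, ∃ N, ∀ r : ℝ, |r - 1| < ε → ∀ y : ℕ → ℝ, (∀ i ≤ N, y i = x i) → r • y ∈ U := by
  have hc : Continuous fun p : ℝ × (ℕ → ℝ) => p.1 • p.2 := continuous_smul
  have hm : (fun p : ℝ × (ℕ → ℝ) => p.1 • p.2) ⁻¹' U ∈ 𝓝 ((1 : ℝ), x) :=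
    (hU.preimage hc).mem_nhds (by simpa using hx)
  rw [nhds_prod_eq] at hm
  obtain ⟨A, hA, B, hB, hAB⟩ := mem_prod_iff.1 hm
  obtain ⟨ε, hε, hεA⟩ := Metric.mem_nhds_iff.1 hA
  obtain ⟨B', hB', hBo, hxB⟩ := mem_nhds_iff.1 hB
  obtain ⟨N, hN⟩ := exists_cylinder_subset hBo hxB
  exact ⟨ε, hε, N, fun r hr y hy => hAB (mk_mem_prod (hεA hr) (hB' (hN y hy)))⟩

lemma exists_pos_mem {U : Set (ℕ → ℝ)} (hU : IsOpen U) (h : (U ∩ slopeSpace).Nonempty) :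
    ∃ x ∈ U ∩ slopeSpace, 0 < x 0 := by
  obtain ⟨x, hxU, hx⟩ := h
  rcases (hx 0).1.1.eq_or_lt with h0 | h0
  · have hx0 := eq_zero_of_zero_eq_zero hx h0.symm
    subst hx0
    have hc : Continuous fun t : ℝ => (fun _ : ℕ => t) := by fun_prop
    obtain ⟨ε, hε, hεU⟩ := Metric.mem_nhds_iff.1 ((hU.preimage hc).mem_nhds
      (show (fun _ : ℕ => (0 : ℝ)) ∈ U from hxU))
    have h1 : 0 < min (ε / 2) 1 := by positivity
    refine ⟨fun _ => min (ε / 2) 1, ⟨hεU ?_, const_mem_slopeSpace ⟨h1.le, min_le_right _ _⟩⟩, h1⟩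
    rw [mem_ball_zero_iff, Real.norm_of_nonneg h1.le]
    exact (min_le_left _ _).trans_lt (by linarith)
  · exact ⟨x, ⟨hxU, hx⟩, h0⟩

/-- The shift on `slopeSpace` is topologically mixing. -/
lemma exists_shift_mem {U V : Set (ℕ → ℝ)} (hU : IsOpen U) (hV : IsOpen V)
    (hUn : (U ∩ slopeSpace).Nonempty) (hVn : (V ∩ slopeSpace).Nonempty) :
    ∃ n₀ : ℕ, ∀ n ≥ n₀, ∃ z ∈ U ∩ slopeSpace, (fun i => z (n + i)) ∈ V := by
  obtain ⟨x, ⟨hxU, hx⟩, hx0⟩ := exists_pos_mem hU hUn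
  obtain ⟨y, ⟨hyV, hy⟩, hy0⟩ := exists_pos_mem hV hVn
  obtain ⟨N, hN⟩ := exists_cylinder_subset hU hxU
  obtain ⟨ε, hε, _, hεV⟩ := exists_smul_mem hV hyV
  obtain ⟨m₀, ρ, hρ, hρε, hm₀⟩ := exists_connection ⟨pos_of_zero_pos hx hx0 N, (hx N).1.2⟩
    ⟨hy0, (hy 0).1.2⟩ hε
  refine ⟨N + m₀, fun n hn => ?_⟩
  obtain ⟨z, hz, hz0, hzn⟩ := hm₀ (ρ • y) (smul_mem_slopeSpace_of_mem_Icc hy ⟨hρ.1.le, hρ.2⟩)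
    rfl (n - N) (by omega)
  refine ⟨_, ⟨hN _ ?_, glue_mem_slopeSpace hx hz hz0⟩, ?_⟩
  · intro i hi
    rcases hi.lt_or_eq with hi | rfl
    · exact if_pos hi
    · simpa using hz0
  · convert hεV ρ (by rw [abs_lt]; constructor <;> linarith [hρ.2]) y (fun _ _ => rfl) using 1
    funext i
    rw [if_neg (by omega), show n + i - N = (n - N) + i by omega, hzn]

/-- The sequences attaining their maximum `1` later than at `0` are dense in `slopeSpace`. -/
lemma exists_eq_one_mem {U : Set (ℕ → ℝ)} (hU : IsOpen U) (h : (U ∩ slopeSpace).Nonempty) :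
    ∃ e ∈ U ∩ slopeSpace, (∃ n, e n = 1) ∧ e 0 < 1 := by
  obtain ⟨x', ⟨hxU', hx'⟩, hx0'⟩ := exists_pos_mem hU h
  obtain ⟨ε', hε', _, hεU'⟩ := exists_smul_mem hU hxU'
  set t : ℝ := 1 - min (ε' / 2) (1 / 2) with ht
  have ht1 : t < 1 := by
    have : 0 < min (ε' / 2) (1 / 2) := by positivity
    linarith
  have ht0 : 0 < t := by
    have : min (ε' / 2) (1 / 2) ≤ 1 / 2 := min_le_right _ _
    linarith
  have htε : |t - 1| < ε' := by
    have : min (ε' / 2) (1 / 2) ≤ ε' / 2 := min_le_left _ _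
    rw [abs_lt]
    constructor <;> linarith
  obtain ⟨x, hxU, hx, hx0, hxt⟩ : ∃ x ∈ U, x ∈ slopeSpace ∧ 0 < x 0 ∧ ∀ n, x n ≤ t :=
    ⟨t • x', hεU' t htε x' fun _ _ => rfl,
      smul_mem_slopeSpace_of_mem_Icc hx' ⟨ht0.le, ht1.le⟩, mul_pos ht0 hx0',
      fun n => mul_le_of_le_one_right ht0.le (hx' n).1.2⟩
  obtain ⟨ε, hε, N, hN⟩ := exists_smul_mem hU hxU
  obtain ⟨M, hM⟩ := exists_nat_one_div_lt (lt_min hε (sub_pos.2 ht1))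
  set δ : ℝ := 1 / ((M : ℝ) + 1) with hδ
  have hδ0 : 0 < δ := by positivity
  have hδε : δ < ε := hM.trans_le (min_le_left _ _)
  have hδt : δ < 1 - t := hM.trans_le (min_le_right _ _)
  have hxN := pos_of_zero_pos hx hx0 N
  obtain ⟨k, hk, hk'⟩ := exists_nat_pow_near ((one_le_div hxN).2 (hx N).1.2)
    (by linarith : 1 < 1 + δ)
  rw [le_div_iff₀ hxN] at hk
  rw [div_lt_iff₀ hxN, pow_succ] at hk'
  set w : ℝ := (1 + δ) ^ k * x N with hw
  have hw0 : 0 < w := by positivity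
  have hw1 : 1 < (1 + δ) * w := by
    calc 1 < (1 + δ) ^ k * (1 + δ) * x N := hk'
      _ = (1 + δ) * w := by ring
  have htw : t < w := by nlinarith
  obtain ⟨z, hz, hz0, hzk, hzi⟩ := exists_prolongation (one_add_mem_slopes M) k
    (const_mem_slopeSpace ⟨hw0.le, hk⟩) (a := x N) (hx N).1 hw
  set g : ℕ → ℝ := fun i => if i < N then x i else z (i - N) with hg
  have hgx : ∀ i ≤ N, g i = x i := by
    intro i hi
    rcases hi.lt_or_eq with hi | rfl
    · exact if_pos hi
    · simpa [hg] using hz0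
  have hgw : ∀ i, g i ≤ w := by
    intro i
    by_cases hi : i < N
    · rw [hgx i hi.le]
      exact (hxt i).trans htw.le
    · simp only [hg, if_neg hi]
      rcases le_total (i - N) k with h1 | h1
      · rw [hzi _ h1, hw]
        gcongr
        linarith
      · obtain ⟨l, hl⟩ := Nat.exists_eq_add_of_le h1
        rw [hl, hzk]
  refine ⟨w⁻¹ • g, ⟨hN _ ?_ g hgx, smul_mem_slopeSpace (glue_mem_slopeSpace hx hz hz0)
    (inv_nonneg.2 hw0.le) fun n => ?_⟩, ⟨N + k, ?_⟩, ?_⟩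
  · have h1 : 1 ≤ w⁻¹ := (one_le_inv₀ hw0).2 hk
    have h2 : w⁻¹ < 1 + δ := by
      rw [inv_lt_iff_one_lt_mul₀ hw0]
      linarith
    rw [abs_lt]
    constructor <;> linarith
  · rw [inv_mul_le_one₀ hw0]
    exact hgw n
  · have : g (N + k) = w := by
      simp only [hg, if_neg (by omega : ¬ N + k < N)]
      rw [Nat.add_sub_cancel_left]
      simpa using hzk 0
    simp [this, hw0.ne']
  · simp only [Pi.smul_apply, smul_eq_mul, hgx 0 (Nat.zero_le N)]
    rw [inv_mul_lt_one₀ hw0]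
    exact (hxt 0).trans_lt htw

end SlopeSpace

section FoldFan

/-- The map folding the constant sequences along `foldMap T` and keeping the other sequences
apart. -/
noncomputable def foldProj (T : Set ℕ) (x : ℕ → ℝ) : ℝ × (ℕ → ℝ) × (ℕ → ℝ) :=
  (foldMap T (x 0), fun n => x (n + 1) - x n, fun n => x 0 * (x (n + 1) - x n))

/-- The fan obtained from `slopeSpace` by folding the leg of the constant sequences. -/
abbrev FoldFan (T : Set ℕ) : Type := ↥(foldProj T '' slopeSpace)

variable {T : Set ℕ}

lemma continuous_foldProj : Continuous (foldProj T) := by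
  have := continuous_foldMap T
  unfold foldProj
  fun_prop

lemma foldProj_eq_iff {x y : ℕ → ℝ} : foldProj T x = foldProj T y ↔
    x = y ∨ ∃ s t, x = (fun _ => s) ∧ y = (fun _ => t) ∧ foldMap T s = foldMap T t := by
  constructor
  · intro h
    simp only [foldProj, Prod.mk.injEq] at h
    obtain ⟨h0, h1, h2⟩ := h
    by_cases hc : ∃ n, x (n + 1) - x n ≠ 0
    · left
      obtain ⟨n, hn⟩ := hc
      have hn2 : x 0 * (x (n + 1) - x n) = y 0 * (y (n + 1) - y n) := congrFun h2 n
      have hn1 : x (n + 1) - x n = y (n + 1) - y n := congrFun h1 n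
      rw [← hn1] at hn2
      have h3 := mul_right_cancel₀ hn hn2
      funext m
      induction m with
      | zero => exact h3
      | succ m ih =>
        have : x (m + 1) - x m = y (m + 1) - y m := congrFun h1 m
        linarith
    · right
      push Not at hc
      have const {z : ℕ → ℝ} (hz : ∀ n, z (n + 1) - z n = 0) : z = fun _ => z 0 := by
        funext m
        induction m with
        | zero => rfl
        | succ m ih => linarith [hz m]
      exact ⟨x 0, y 0, const hc, const fun n => (congrFun h1 n).symm.trans (hc n), h0⟩
  · rintro (rfl | ⟨s, t, rfl, rfl, h⟩)
    · rfl
    · simp [foldProj, h]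

instance : CompactSpace (FoldFan T) :=
  isCompact_iff_compactSpace.1 (isCompact_slopeSpace.image continuous_foldProj)

/-- The projection of `slopeSpace` onto `FoldFan T`. -/
noncomputable def fanProj (T : Set ℕ) (x : slopeSpace) : FoldFan T :=
  ⟨foldProj T x, mem_image_of_mem _ x.2⟩

lemma continuous_fanProj : Continuous (fanProj T) :=
  (continuous_foldProj.comp continuous_subtype_val).subtype_mk _

lemma surjective_fanProj : Function.Surjective (fanProj T) := by
  rintro ⟨_, x, hx, rfl⟩
  exact ⟨⟨x, hx⟩, rfl⟩

lemma fanProj_eq_iff {x y : slopeSpace} : fanProj T x = fanProj T y ↔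
    x = y ∨ ∃ s t, x.1 = (fun _ => s) ∧ y.1 = (fun _ => t) ∧ foldMap T s = foldMap T t := by
  rw [fanProj, fanProj, Subtype.mk.injEq, foldProj_eq_iff, Subtype.ext_iff]

/-- The multiple `r • x` of a sequence. -/
def slopeSMul (r : I) (x : slopeSpace) : slopeSpace :=
  ⟨(r : ℝ) • x.1, smul_mem_slopeSpace_of_mem_Icc x.2 r.2⟩

lemma continuous_slopeSMul : Continuous fun p : I × slopeSpace => slopeSMul p.1 p.2 := by
  unfold slopeSMul
  fun_prop

/-- The constant sequence. -/
def slopeConst (t : I) : slopeSpace := ⟨fun _ => (t : ℝ), const_mem_slopeSpace t.2⟩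

lemma foldMap_mem_unitInterval (T : Set ℕ) (t : I) : foldMap T t ∈ I := foldMap_mem_Icc T t.2

/-- The folded leg. -/
noncomputable def foldLeg (T : Set ℕ) (u : I) : FoldFan T :=
  ⟨(u, 0, 0), by
    obtain ⟨t, ht, h⟩ := exists_foldMap_eq T (right_mem_Icc.2 zero_le_one)
      (u := u) (by rw [foldMap_one]; exact u.2)
    exact ⟨fun _ => t, const_mem_slopeSpace ht, by simp [foldProj, h]; rfl⟩⟩

lemma continuous_foldLeg : Continuous (foldLeg T) := by
  unfold foldLeg
  fun_prop

lemma injective_foldLeg : Function.Injective (foldLeg T) := by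
  intro u w h
  simpa [foldLeg, Subtype.ext_iff] using h

lemma fanProj_slopeConst (t : I) :
    fanProj T (slopeConst t) = foldLeg T ⟨foldMap T t, foldMap_mem_unitInterval T t⟩ := by
  simp only [fanProj, slopeConst, foldLeg, foldProj, sub_self, mul_zero, Subtype.mk.injEq,
    Prod.mk.injEq, true_and]
  exact ⟨rfl, rfl⟩

lemma exists_fanProj_slopeConst_eq (u : I) : ∃ t : I, fanProj T (slopeConst t) = foldLeg T u := by
  obtain ⟨t, ht, h⟩ := exists_foldMap_eq T (right_mem_Icc.2 zero_le_one)
    (u := u) (by rw [foldMap_one]; exact u.2)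
  refine ⟨⟨t, ht⟩, ?_⟩
  rw [fanProj_slopeConst]
  congr

lemma exists_slopeConst_eq {x : slopeSpace} {s : ℝ} (h : x.1 = fun _ => s) :
    ∃ t : I, (t : ℝ) = s ∧ x = slopeConst t := by
  have h0 : s ∈ I := by
    have := (x.2 0).1
    rwa [h] at this
  exact ⟨⟨s, h0⟩, rfl, Subtype.ext h⟩

lemma fanProj_eq_foldLeg_iff {x : slopeSpace} {u : I} :
    fanProj T x = foldLeg T u ↔ ∃ t : I, x = slopeConst t ∧ foldMap T t = u := by
  constructor
  · intro h
    obtain ⟨t, ht⟩ := exists_fanProj_slopeConst_eq (T := T) u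
    rw [← ht] at h
    have key : ∃ s : I, x = slopeConst s := by
      rcases fanProj_eq_iff.1 h with rfl | ⟨s, -, hs, -, -⟩
      · exact ⟨t, rfl⟩
      · obtain ⟨s, -, hs⟩ := exists_slopeConst_eq hs
        exact ⟨s, hs⟩
    obtain ⟨s, rfl⟩ := key
    refine ⟨s, rfl, ?_⟩
    rw [ht, fanProj_slopeConst] at h
    exact congrArg Subtype.val (injective_foldLeg h)
  · rintro ⟨t, rfl, h⟩
    rw [fanProj_slopeConst]
    congr

lemma fanProj_eq_foldLeg_zero_iff {x : slopeSpace} : fanProj T x = foldLeg T 0 ↔ x.1 0 = 0 := by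
  rw [fanProj_eq_foldLeg_iff]
  constructor
  · rintro ⟨t, rfl, h⟩
    exact le_antisymm ((le_foldMap T t).trans h.le) t.2.1
  · intro h
    exact ⟨0, Subtype.ext (eq_zero_of_zero_eq_zero x.2 h), foldMap_zero T⟩

lemma eq_of_fanProj_eq {x y : slopeSpace} (h : fanProj T x = fanProj T y)
    (hx : ∀ t, x ≠ slopeConst t) : x = y := by
  rcases fanProj_eq_iff.1 h with h | ⟨s, -, hs, -, -⟩
  · exact h
  · obtain ⟨t, -, ht⟩ := exists_slopeConst_eq hs
    exact absurd ht (hx t)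

/-- The ends of the legs of `slopeSpace`. -/
abbrev LegIndex : Type := {e : slopeSpace // IsLUB (range e.1) 1}

/-- The index of the leg of constant sequences. -/
def constIndex : LegIndex := ⟨slopeConst 1, by
  simp [slopeConst]⟩

open Classical in
/-- The legs of `FoldFan T`. -/
noncomputable def fanLeg (T : Set ℕ) (e : LegIndex) (t : I) : FoldFan T :=
  if e = constIndex then foldLeg T t else fanProj T (slopeSMul t e.1)

lemma fanLeg_constIndex : fanLeg T constIndex = foldLeg T := by
  funext t
  simp [fanLeg]

lemma fanLeg_of_ne {e : LegIndex} (he : e ≠ constIndex) (t : I) :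
    fanLeg T e t = fanProj T (slopeSMul t e.1) := if_neg he

lemma slopeSMul_constIndex (r : I) : slopeSMul r constIndex.1 = slopeConst r :=
  Subtype.ext (by funext n; simp [slopeSMul, constIndex, slopeConst])

/-- Two ends of legs with a common multiple agree. -/
lemma eq_of_smul_eq {e e' : LegIndex} {a b : I}
    (h : slopeSMul a e.1 = slopeSMul b e'.1) (ha : a ≠ 0) : e = e' ∧ a = b := by
  have h1 : ∀ n, (a : ℝ) * e.1.1 n = b * e'.1.1 n := fun n =>
    congrFun (congrArg Subtype.val h) n
  have key {e e' : LegIndex} {a b : I} (h1 : ∀ n, (a : ℝ) * e.1.1 n = b * e'.1.1 n)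
      (ha : 0 < (a : ℝ)) : (a : ℝ) ≤ b := by
    have : (1 : ℝ) ≤ b / a := e.2.2 (by
      rintro _ ⟨n, rfl⟩
      rw [le_div_iff₀ ha, mul_comm, h1]
      exact mul_le_of_le_one_right b.2.1 (e'.1.2 n).1.2)
    rwa [one_le_div ha] at this
  have ha0 : 0 < (a : ℝ) := lt_of_le_of_ne a.2.1 fun h => ha (Subtype.ext h.symm)
  have hab := key h1 ha0
  have hba := key (fun n => (h1 n).symm) (ha0.trans_le hab)
  have hab' : (a : ℝ) = b := le_antisymm hab hba
  refine ⟨Subtype.ext (Subtype.ext (funext fun n => ?_)), Subtype.ext hab'⟩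
  have := h1 n
  rw [← hab'] at this
  exact mul_left_cancel₀ ha0.ne' this

lemma slopeSMul_ne_slopeConst {e : LegIndex} (he : e ≠ constIndex) {a : I} (ha : a ≠ 0) (t : I) :
    slopeSMul a e.1 ≠ slopeConst t := by
  intro h
  rw [← slopeSMul_constIndex] at h
  exact he (eq_of_smul_eq h ha).1

lemma exists_slopeSMul_eq (x : slopeSpace) :
    ∃ (e : LegIndex) (b : I), slopeSMul b e.1 = x := by
  rcases (x.2 0).1.1.eq_or_lt with h0 | h0
  · refine ⟨constIndex, 0, ?_⟩
    rw [slopeSMul_constIndex]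
    exact Subtype.ext (eq_zero_of_zero_eq_zero x.2 h0.symm).symm
  · have hbdd : BddAbove (range x.1) := ⟨1, by
      rintro _ ⟨n, rfl⟩
      exact (x.2 n).1.2⟩
    obtain ⟨b, hb⟩ : ∃ b, IsLUB (range x.1) b := Real.exists_isLUB ⟨_, 0, rfl⟩ hbdd
    have hxb : ∀ n, x.1 n ≤ b := fun n => hb.1 ⟨n, rfl⟩
    have hb0 : 0 < b := h0.trans_le (hxb 0)
    have hb1 : b ≤ 1 := hb.2 (by
      rintro _ ⟨n, rfl⟩
      exact (x.2 n).1.2)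
    have hle : ∀ n, b⁻¹ * x.1 n ≤ 1 := fun n => (inv_mul_le_one₀ hb0).2 (hxb n)
    refine ⟨⟨⟨b⁻¹ • x.1, smul_mem_slopeSpace x.2 (inv_nonneg.2 hb0.le) hle⟩, ?_, ?_⟩,
      ⟨b, hb0.le, hb1⟩, ?_⟩
    · rintro _ ⟨n, rfl⟩
      exact hle n
    · intro c hc
      have : b ≤ b * c := hb.2 (by
        rintro _ ⟨n, rfl⟩
        have : b⁻¹ * x.1 n ≤ c := hc ⟨n, rfl⟩
        rwa [inv_mul_le_iff₀ hb0] at this)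
      exact le_of_mul_le_mul_left (by linarith) hb0
    · exact Subtype.ext (smul_inv_smul₀ hb0.ne' x.1)

lemma fanProj_slopeSMul_mem_range (e : LegIndex) (b : I) :
    fanProj T (slopeSMul b e.1) ∈ range (fanLeg T e) := by
  by_cases he : e = constIndex
  · subst he
    rw [slopeSMul_constIndex, fanProj_slopeConst, fanLeg_constIndex]
    exact ⟨_, rfl⟩
  · exact ⟨b, fanLeg_of_ne he b⟩

lemma exists_fanProj_eq_fanLeg (e : LegIndex) (b : I) :
    ∃ t, fanProj T (slopeSMul t e.1) = fanLeg T e b := by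
  by_cases he : e = constIndex
  · subst he
    obtain ⟨t, ht⟩ := exists_fanProj_slopeConst_eq (T := T) b
    exact ⟨t, by rw [slopeSMul_constIndex, ht, fanLeg_constIndex]⟩
  · exact ⟨b, (fanLeg_of_ne he b).symm⟩

/-- Proportional sequences lie on the same leg. -/
lemma exists_slopeSMul_eq_of_smul_eq {e : LegIndex} {y : slopeSpace} {r : ℝ} (hr : 0 ≤ r)
    (h : y.1 = r • e.1.1) : ∃ b : I, slopeSMul b e.1 = y := by
  suffices hr1 : r ≤ 1 from ⟨⟨r, hr, hr1⟩, Subtype.ext h.symm⟩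
  rcases hr.eq_or_lt with h0 | h0
  · rw [← h0]
    exact zero_le_one
  · have : (1 : ℝ) ≤ r⁻¹ := e.2.2 (by
      rintro _ ⟨n, rfl⟩
      rw [← one_div, le_div_iff₀ h0, mul_comm]
      have := (y.2 n).1.2
      rwa [h] at this)
    exact (one_le_inv₀ h0).1 this

/-- A connected set avoiding the top cannot be crossed by a ratio which is not a slope. -/
lemma ratio_le_of_isPreconnected {K : Set (FoldFan T)} (hK : IsPreconnected K)
    (hv : foldLeg T 0 ∉ K) {x y : slopeSpace} (hx : fanProj T x ∈ K) (hy : fanProj T y ∈ K)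
    (n : ℕ) : y.1 (n + 1) / y.1 n ≤ x.1 (n + 1) / x.1 n := by
  by_contra! hlt
  obtain ⟨θ, hθ, hxθ, hθy⟩ := exists_irrational_btwn hlt
  have hpos {z : slopeSpace} (hz : fanProj T z ∈ K) (m : ℕ) : 0 < z.1 m := by
    refine pos_of_zero_pos z.2 (lt_of_le_of_ne (z.2 0).1.1 fun h => hv ?_) m
    rwa [← fanProj_eq_foldLeg_zero_iff.2 h.symm]
  rw [div_lt_iff₀ (hpos hx n)] at hxθ
  rw [lt_div_iff₀ (hpos hy n)] at hθy
  have hcont (m : ℕ) : Continuous fun z : slopeSpace => z.1 m :=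
    (continuous_apply m).comp continuous_subtype_val
  have hcompact : CompactSpace slopeSpace := isCompact_iff_compactSpace.1 isCompact_slopeSpace
  have hclosed : IsClosedMap (fanProj T) := continuous_fanProj.isClosedMap
  obtain ⟨p, hp, ⟨x', hx', rfl⟩, ⟨y', hy', hxy⟩⟩ := isPreconnected_closed_iff.1 hK
    (fanProj T '' {z | z.1 (n + 1) ≤ θ * z.1 n}) (fanProj T '' {z | θ * z.1 n ≤ z.1 (n + 1)})
    (hclosed _ (isClosed_le (hcont _) (continuous_const.mul (hcont _))))
    (hclosed _ (isClosed_le (continuous_const.mul (hcont _)) (hcont _)))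
    (by
      intro p _
      obtain ⟨z, rfl⟩ := surjective_fanProj p
      exact (le_total (z.1 (n + 1)) (θ * z.1 n)).imp (fun h => ⟨z, h, rfl⟩) fun h => ⟨z, h, rfl⟩)
    ⟨_, hx, x, hxθ.le, rfl⟩ ⟨_, hy, y, hθy.le, rfl⟩
  simp only [mem_ofPred_eq] at hx' hy'
  have hx0 := hpos hp
  have hy0 := hpos (hxy ▸ hp)
  rcases fanProj_eq_iff.1 hxy with rfl | ⟨s, t, hs, ht, -⟩
  · obtain ⟨-, c, hc, hcn⟩ := y'.2 n
    have : θ = c := mul_right_cancel₀ (hx0 n).ne' (by linarith)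
    exact not_irrational_of_mem_slopes hc (this ▸ hθ)
  · have h1 := hx0 0
    have h2 := hy0 0
    simp only [hs, ht] at hx' hy' h1 h2
    exact hθ.ne_one (by nlinarith)

lemma isLegSystem_fanLeg (T : Set ℕ) : IsLegSystem (foldLeg T 0) (fanLeg T) where
  continuous_leg e := by
    by_cases he : e = constIndex
    · rw [he, fanLeg_constIndex]
      exact continuous_foldLeg
    · rw [funext (fanLeg_of_ne he)]
      exact continuous_fanProj.comp
        (continuous_slopeSMul.comp (continuous_id.prodMk continuous_const))
  injective_leg e a b h := by
    by_cases he : e = constIndex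
    · rw [he, fanLeg_constIndex] at h
      exact injective_foldLeg h
    · rw [fanLeg_of_ne he, fanLeg_of_ne he] at h
      by_cases ha : a = 0
      · by_cases hb : b = 0
        · rw [ha, hb]
        · exact (eq_of_smul_eq (eq_of_fanProj_eq h.symm (slopeSMul_ne_slopeConst he hb)) hb).2.symm
      · exact (eq_of_smul_eq (eq_of_fanProj_eq h (slopeSMul_ne_slopeConst he ha)) ha).2
  leg_zero e := by
    by_cases he : e = constIndex
    · rw [he, fanLeg_constIndex]
    · rw [fanLeg_of_ne he, fanProj_eq_foldLeg_zero_iff]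
      simp [slopeSMul]
  exists_leg p := by
    obtain ⟨x, rfl⟩ := surjective_fanProj p
    obtain ⟨e, b, rfl⟩ := exists_slopeSMul_eq x
    exact ⟨e, fanProj_slopeSMul_mem_range e b⟩
  eq_of_meet i j a b h hv := by
    obtain ⟨s, hs⟩ := exists_fanProj_eq_fanLeg (T := T) i a
    obtain ⟨t, ht⟩ := exists_fanProj_eq_fanLeg (T := T) j b
    have h' := h ▸ hv
    rw [← hs, ← ht] at h
    rw [← hs, Ne, fanProj_eq_foldLeg_zero_iff] at hv
    rw [← ht, Ne, fanProj_eq_foldLeg_zero_iff] at h'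
    have hs0 : s ≠ 0 := by
      rintro rfl
      exact hv (by simp [slopeSMul])
    have ht0 : t ≠ 0 := by
      rintro rfl
      exact h' (by simp [slopeSMul])
    by_cases hi : i = constIndex
    · by_cases hj : j = constIndex
      · rw [hi, hj]
      · exact (eq_of_smul_eq
          (eq_of_fanProj_eq h.symm (slopeSMul_ne_slopeConst hj ht0)) ht0).1.symm
    · exact (eq_of_smul_eq (eq_of_fanProj_eq h (slopeSMul_ne_slopeConst hi hs0)) hs0).1
  subset_leg K hK hv := by
    rcases K.eq_empty_or_nonempty with rfl | ⟨p, hp⟩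
    · exact ⟨constIndex, empty_subset _⟩
    obtain ⟨x, rfl⟩ := surjective_fanProj p
    obtain ⟨e, b, rfl⟩ := exists_slopeSMul_eq x
    refine ⟨e, fun q hq => ?_⟩
    obtain ⟨y, rfl⟩ := surjective_fanProj q
    have hx0 : 0 < (slopeSMul b e.1).1 0 := by
      refine lt_of_le_of_ne ((slopeSMul b e.1).2 0).1.1 fun h => hv ?_
      rwa [← fanProj_eq_foldLeg_zero_iff.2 h.symm]
    have hy0 : 0 < y.1 0 := by
      refine lt_of_le_of_ne (y.2 0).1.1 fun h => hv ?_
      rwa [← fanProj_eq_foldLeg_zero_iff.2 h.symm]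
    have hr (n : ℕ) : y.1 n = y.1 0 / (slopeSMul b e.1).1 0 * (slopeSMul b e.1).1 n := by
      induction n with
      | zero => field_simp
      | succ n ih =>
        have h1 := le_antisymm (ratio_le_of_isPreconnected hK hv hp hq n)
          (ratio_le_of_isPreconnected hK hv hq hp n)
        have hxn := pos_of_zero_pos (slopeSMul b e.1).2 hx0 n
        have hyn := pos_of_zero_pos y.2 hy0 n
        rw [div_eq_div_iff hyn.ne' hxn.ne', ih] at h1
        refine mul_right_cancel₀ hxn.ne' (h1.trans ?_)
        ring
    obtain ⟨c, rfl⟩ := exists_slopeSMul_eq_of_smul_eq (e := e) (y := y)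
      (r := y.1 0 / (slopeSMul b e.1).1 0 * b) (by have := b.2.1; positivity) (by
        funext n
        rw [hr n]
        simp [slopeSMul, mul_assoc])
    exact fanProj_slopeSMul_mem_range e c

end FoldFan

section FanDynamics

variable {T : Set ℕ}

/-- The shift on `slopeSpace`. -/
def slopeShift (x : slopeSpace) : slopeSpace := ⟨fun n => x.1 (n + 1), shift_mem_slopeSpace x.2⟩

lemma continuous_slopeShift : Continuous slopeShift := by
  unfold slopeShift
  refine Continuous.subtype_mk (continuous_pi fun n => ?_) _
  exact (continuous_apply (n + 1)).comp continuous_subtype_val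

lemma iterate_slopeShift (n : ℕ) (x : slopeSpace) (i : ℕ) :
    (slopeShift^[n] x).1 i = x.1 (n + i) := by
  induction n generalizing x with
  | zero => simp
  | succ n ih =>
    rw [Function.iterate_succ_apply, ih]
    exact congrArg x.1 (by omega)

/-- The map of `FoldFan T` induced by the shift. -/
noncomputable def fanShift (T : Set ℕ) (p : FoldFan T) : FoldFan T :=
  fanProj T (slopeShift (Function.surjInv surjective_fanProj p))

lemma fanShift_fanProj (x : slopeSpace) :
    fanShift T (fanProj T x) = fanProj T (slopeShift x) := by
  rcases fanProj_eq_iff.1 (Function.surjInv_eq surjective_fanProj (fanProj T x)) with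
    h | ⟨s, t, hs, ht, h⟩
  · rw [fanShift, h]
  · rw [fanShift, fanProj_eq_iff]
    exact Or.inr ⟨s, t, by simp only [slopeShift, hs], by simp only [slopeShift, ht], h⟩

lemma iterate_fanShift_fanProj (n : ℕ) (x : slopeSpace) :
    (fanShift T)^[n] (fanProj T x) = fanProj T (slopeShift^[n] x) :=
  ((show Function.Semiconj (fanProj T) slopeShift (fanShift T) from
    fun x => (fanShift_fanProj x).symm).iterate_right n x).symm

lemma continuous_fanShift : Continuous (fanShift T) := by
  have : CompactSpace slopeSpace := isCompact_iff_compactSpace.1 isCompact_slopeSpace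
  have hq : IsQuotientMap (fanProj T) :=
    continuous_fanProj.isClosedMap.isQuotientMap continuous_fanProj surjective_fanProj
  rw [hq.continuous_iff]
  have : fanShift T ∘ fanProj T = fanProj T ∘ slopeShift := funext fanShift_fanProj
  rw [this]
  exact continuous_fanProj.comp continuous_slopeShift

lemma surjective_fanShift : Function.Surjective (fanShift T) := by
  intro p
  obtain ⟨x, rfl⟩ := surjective_fanProj p
  refine ⟨fanProj T ⟨seqCons (x.1 0) x.1,
    seqCons_mem_slopeSpace x.2 (x.2 0).1 one_mem_slopes (one_mul _).symm⟩, ?_⟩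
  rw [fanShift_fanProj]
  rfl

lemma not_injective_fanShift : ¬ Function.Injective (fanShift T) := by
  intro hinj
  have hx : (fun _ => 1 / 4 : ℕ → ℝ) ∈ slopeSpace := const_mem_slopeSpace (by norm_num)
  have hy : seqCons (1 / 2) (fun _ => 1 / 4) ∈ slopeSpace :=
    seqCons_mem_slopeSpace hx (by norm_num) half_mem_slopes (by norm_num)
  have h : fanShift T (fanProj T ⟨_, hy⟩) = fanShift T (fanProj T ⟨_, hx⟩) := by
    rw [fanShift_fanProj, fanShift_fanProj]
    rfl
  rcases fanProj_eq_iff.1 (hinj h) with h | ⟨s, -, h, -, -⟩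
  · have := congrFun (congrArg Subtype.val h) 0
    norm_num [seqCons] at this
  · have h0 : (1 / 2 : ℝ) = s := congrFun h 0
    have h1 : (1 / 4 : ℝ) = s := congrFun h 1
    norm_num [← h1] at h0

lemma topologicallyMixing_fanShift : TopologicallyMixing (fanShift T) := by
  have key {U : Set (FoldFan T)} (hU : IsOpen U) (hUn : U.Nonempty) :
      ∃ U' : Set (ℕ → ℝ), IsOpen U' ∧ (U' ∩ slopeSpace).Nonempty ∧
        ∀ x : slopeSpace, x.1 ∈ U' → fanProj T x ∈ U := by
    obtain ⟨U', hU', h⟩ := isOpen_induced_iff.1 (hU.preimage continuous_fanProj)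
    obtain ⟨p, hp⟩ := hUn
    obtain ⟨x, rfl⟩ := surjective_fanProj p
    have hmem (x : slopeSpace) : x.1 ∈ U' ↔ fanProj T x ∈ U := Set.ext_iff.1 h x
    exact ⟨U', hU', ⟨x, (hmem x).2 hp, x.2⟩, fun x => (hmem x).1⟩
  intro U V hU hV hUn hVn
  obtain ⟨U', hU', hUn', hUU'⟩ := key hU hUn
  obtain ⟨V', hV', hVn', hVV'⟩ := key hV hVn
  obtain ⟨n₀, h⟩ := exists_shift_mem hU' hV' hUn' hVn'
  refine ⟨n₀, fun n hn => ?_⟩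
  obtain ⟨z, ⟨hzU, hz⟩, hzV⟩ := h n hn
  refine ⟨_, mem_image_of_mem _ (hUU' ⟨z, hz⟩ hzU), ?_⟩
  rw [iterate_fanShift_fanProj]
  refine hVV' _ ?_
  rwa [show (slopeShift^[n] ⟨z, hz⟩).1 = fun i => z (n + i) from
    funext fun i => iterate_slopeShift n _ i]

/-- The ends attaining their maximum later than at `0`. -/
def lateEnds : Set slopeSpace := {e | (∃ n, e.1 n = 1) ∧ e.1 0 < 1}

lemma dense_lateEnds : Dense lateEnds := by
  rw [dense_iff_inter_open]
  rintro U hU ⟨x, hx⟩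
  obtain ⟨U', hU', rfl⟩ := isOpen_induced_iff.1 hU
  obtain ⟨e, ⟨heU, he⟩, h⟩ := exists_eq_one_mem hU' ⟨x.1, hx, x.2⟩
  exact ⟨⟨e, he⟩, heU, h⟩

lemma exists_index_of_mem_lateEnds {e : slopeSpace} (h : e ∈ lateEnds) :
    ∃ i : LegIndex, i ≠ constIndex ∧ i.1 = e := by
  obtain ⟨⟨n, hn⟩, h0⟩ := h
  refine ⟨⟨e, IsGreatest.isLUB ⟨⟨n, hn⟩, ?_⟩⟩, ?_, rfl⟩
  · rintro _ ⟨m, rfl⟩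
    exact (e.2 m).1.2
  · rintro h
    obtain rfl : e = slopeConst 1 := congrArg Subtype.val h
    simp [slopeConst] at h0

lemma slopeSMul_one (x : slopeSpace) : slopeSMul 1 x = x := Subtype.ext (one_smul ℝ x.1)

lemma isLelekLikeFan_foldFan (T : Set ℕ) : IsLelekLikeFan (FoldFan T) := by
  refine ⟨(isLegSystem_fanLeg T).isFan, ?_⟩
  refine (surjective_fanProj.denseRange.dense_image continuous_fanProj dense_lateEnds).mono ?_
  rintro _ ⟨e, he, rfl⟩
  obtain ⟨i, hi, rfl⟩ := exists_index_of_mem_lateEnds he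
  have := (isLegSystem_fanLeg T).leg_one_mem_dendroidEndpoints i
  rwa [fanLeg_of_ne hi, slopeSMul_one] at this

end FanDynamics

section FanInvariants

variable {T : Set ℕ}

lemma isBelow_foldLeg_iff {w u : I} :
    IsBelow (foldLeg T 0) (foldLeg T w) (foldLeg T u) ↔ w ≤ u := by
  have h := (isLegSystem_fanLeg T).isBelow_leg_iff (i := constIndex) (z := foldLeg T w) (b := u)
  rw [fanLeg_constIndex] at h
  rw [h]
  constructor
  · rintro ⟨a, ha, h⟩
    rwa [← injective_foldLeg h]
  · exact fun h => ⟨w, h, rfl⟩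

lemma exists_mul_eq {s t : I} (h : t ≤ s) : ∃ r : I, r * s = t := by
  rcases s.2.1.eq_or_lt with h0 | h0
  · refine ⟨0, Subtype.ext ?_⟩
    have h1 : (t : ℝ) ≤ s := h
    have := t.2.1
    simp only [zero_mul, Icc.coe_zero]
    linarith
  · exact ⟨⟨t / s, div_nonneg t.2.1 s.2.1, (div_le_one h0).2 h⟩,
      Subtype.ext (div_mul_cancel₀ _ h0.ne')⟩

lemma slopeSMul_slopeSMul (r s : I) (x : slopeSpace) :
    slopeSMul r (slopeSMul s x) = slopeSMul (r * s) x := by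
  refine Subtype.ext ?_
  simp [slopeSMul, smul_smul]

lemma slopeSMul_slopeConst (r t : I) : slopeSMul r (slopeConst t) = slopeConst (r * t) := by
  rw [← slopeSMul_constIndex, ← slopeSMul_constIndex, slopeSMul_slopeSMul]

lemma exists_of_isBelow {z y : FoldFan T} (h : IsBelow (foldLeg T 0) z y) :
    ∃ (r : I) (x : slopeSpace), z = fanProj T (slopeSMul r x) ∧ y = fanProj T x := by
  obtain ⟨e, b, rfl⟩ := (isLegSystem_fanLeg T).exists_leg y
  obtain ⟨a, hab, rfl⟩ := (isLegSystem_fanLeg T).isBelow_leg_iff.1 h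
  by_cases he : e = constIndex
  · subst he
    simp only [fanLeg_constIndex]
    obtain ⟨s, hs⟩ := exists_fanProj_slopeConst_eq (T := T) b
    have hs' : foldMap T s = b := by
      rw [fanProj_slopeConst] at hs
      exact congrArg Subtype.val (injective_foldLeg hs)
    obtain ⟨t, ht, hta⟩ := exists_foldMap_eq T s.2 (u := a) ⟨a.2.1, hs'.symm ▸ hab⟩
    obtain ⟨r, hr⟩ := exists_mul_eq (s := s) (t := ⟨t, ht.1, ht.2.trans s.2.2⟩) ht.2
    refine ⟨r, slopeConst s, ?_, hs.symm⟩
    rw [slopeSMul_slopeConst, hr, fanProj_slopeConst]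
    exact congrArg _ (Subtype.ext hta.symm)
  · obtain ⟨r, rfl⟩ := exists_mul_eq hab
    exact ⟨r, slopeSMul b e.1, by rw [fanLeg_of_ne he, slopeSMul_slopeSMul], fanLeg_of_ne he b⟩

lemma exists_of_isLimitBelow {z y : FoldFan T} (h : IsLimitBelow (foldLeg T 0) z y) :
    ∃ (r : I) (x : slopeSpace), z = fanProj T (slopeSMul r x) ∧ y = fanProj T x := by
  have : CompactSpace slopeSpace := isCompact_iff_compactSpace.1 isCompact_slopeSpace
  have hcl : IsClosed (range fun p : I × slopeSpace =>
      (fanProj T (slopeSMul p.1 p.2), fanProj T p.2)) :=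
    (isCompact_range ((continuous_fanProj.comp continuous_slopeSMul).prodMk
      (continuous_fanProj.comp continuous_snd))).isClosed
  obtain ⟨⟨r, x⟩, hrx⟩ := closure_minimal (t := range fun p : I × slopeSpace =>
      (fanProj T (slopeSMul p.1 p.2), fanProj T p.2)) (by
    rintro ⟨z, y⟩ hzy
    obtain ⟨r, x, rfl, rfl⟩ := exists_of_isBelow hzy
    exact ⟨(r, x), rfl⟩) hcl h
  simp only [Prod.mk.injEq] at hrx
  exact ⟨r, x, hrx.1.symm, hrx.2.symm⟩

lemma isBelow_of_isLimitBelow {z y : FoldFan T} (h : IsLimitBelow (foldLeg T 0) z y)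
    (hy : y ∉ range (foldLeg T)) : IsBelow (foldLeg T 0) z y := by
  obtain ⟨r, x, rfl, rfl⟩ := exists_of_isLimitBelow h
  obtain ⟨e, b, rfl⟩ := exists_slopeSMul_eq x
  have he : e ≠ constIndex := by
    rintro rfl
    refine hy ?_
    rw [slopeSMul_constIndex, fanProj_slopeConst]
    exact ⟨_, rfl⟩
  rw [slopeSMul_slopeSMul, ← fanLeg_of_ne he, ← fanLeg_of_ne he]
  exact (isLegSystem_fanLeg T).isBelow_leg_iff.2 ⟨_, mul_le_of_le_one_left' r.2.2, rfl⟩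

lemma isLimitBelow_fanProj_slopeConst {s t : I} (h : s ≤ t) :
    IsLimitBelow (foldLeg T 0) (fanProj T (slopeConst s)) (fanProj T (slopeConst t)) := by
  have hc (r : I) : Continuous fun e : slopeSpace => fanProj T (slopeSMul r e) :=
    continuous_fanProj.comp (continuous_slopeSMul.comp (continuous_const.prodMk continuous_id))
  have := map_mem_closure ((hc s).prodMk (hc t)) (dense_lateEnds constIndex.1)
    (t := {p | IsBelow (foldLeg T 0) p.1 p.2}) (by
      intro e he
      obtain ⟨i, hi, rfl⟩ := exists_index_of_mem_lateEnds he
      change IsBelow _ (fanProj T (slopeSMul s i.1)) (fanProj T (slopeSMul t i.1))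
      rw [← fanLeg_of_ne hi, ← fanLeg_of_ne hi]
      exact (isLegSystem_fanLeg T).isBelow_leg_iff.2 ⟨s, h, rfl⟩)
  simp only [slopeSMul_constIndex] at this
  exact this

lemma isLimitBelow_foldLeg_iff {z : FoldFan T} {u : I} :
    IsLimitBelow (foldLeg T 0) z (foldLeg T u) ↔ ∃ w, z = foldLeg T w ∧ FoldRel T w u := by
  constructor
  · intro h
    obtain ⟨r, x, rfl, hx⟩ := exists_of_isLimitBelow h
    obtain ⟨t, rfl, ht⟩ := fanProj_eq_foldLeg_iff.1 hx.symm
    refine ⟨_, by rw [slopeSMul_slopeConst, fanProj_slopeConst], (r * t : I), t, (r * t : I).2.1,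
      mul_le_of_le_one_left t.2.1 r.2.2, t.2.2, rfl, ht⟩
  · rintro ⟨w, rfl, s, t, h0, hst, h1, hs, ht⟩
    have hs' := fanProj_eq_foldLeg_iff.2 ⟨⟨s, h0, hst.trans h1⟩, rfl, hs⟩
    have ht' := fanProj_eq_foldLeg_iff.2 ⟨⟨t, h0.trans hst, h1⟩, rfl, ht⟩
    rw [← hs', ← ht']
    exact isLimitBelow_fanProj_slopeConst hst

lemma FoldRel.mem_left {w u : ℝ} (h : FoldRel T w u) : w ∈ I := by
  obtain ⟨s, t, h0, hst, h1, rfl, -⟩ := h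
  exact foldMap_mem_Icc T ⟨h0, hst.trans h1⟩

lemma FoldRel.mem_right {w u : ℝ} (h : FoldRel T w u) : u ∈ I := by
  obtain ⟨s, t, h0, hst, h1, -, rfl⟩ := h
  exact foldMap_mem_Icc T ⟨h0.trans hst, h1⟩

/-- The `k`-th peak of the folded leg. -/
noncomputable def fanPeak (T : Set ℕ) (k : ℕ) : I := ⟨foldPeak T k, foldPeak_mem_Icc T k⟩

lemma fanPeak_strictMono (T : Set ℕ) : StrictMono (fanPeak T) := fun _ _ h =>
  foldPeak_strictMono T h

lemma mem_peakPoints_iff {z : FoldFan T} :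
    z ∈ peakPoints (foldLeg T 0) ↔ ∃ k, foldLeg T (fanPeak T k) = z := by
  constructor
  · rintro ⟨y, h1, h2, h3⟩
    obtain ⟨u, rfl⟩ : y ∈ range (foldLeg T) := by
      by_contra hy
      exact h2 (isBelow_of_isLimitBelow h1 hy)
    obtain ⟨w, rfl, hw⟩ := isLimitBelow_foldLeg_iff.1 h1
    rw [isBelow_foldLeg_iff, not_le] at h2
    obtain ⟨k, hk⟩ := (exists_isGreatest_foldRel_iff T w).1 ⟨u, hw, h2, fun w' hw' =>
      isBelow_foldLeg_iff.1 (h3 _ (isLimitBelow_foldLeg_iff.2 ⟨⟨w', hw'.mem_left⟩, rfl, hw'⟩))⟩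
    exact ⟨k, congrArg _ (Subtype.ext hk)⟩
  · rintro ⟨k, rfl⟩
    obtain ⟨u, h1, h2, h3⟩ := (exists_isGreatest_foldRel_iff T (fanPeak T k)).2 ⟨k, rfl⟩
    refine ⟨foldLeg T ⟨u, h1.mem_right⟩, isLimitBelow_foldLeg_iff.2 ⟨_, rfl, h1⟩, ?_, ?_⟩
    · rw [isBelow_foldLeg_iff, not_le]
      exact h2
    · intro z' hz'
      obtain ⟨w, rfl, hw⟩ := isLimitBelow_foldLeg_iff.1 hz'
      exact isBelow_foldLeg_iff.2 (h3 _ hw)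

lemma fanPeak_mem_nonsmoothPoints_iff {k : ℕ} :
    foldLeg T (fanPeak T k) ∈ nonsmoothPoints (foldLeg T 0) ↔ k ∈ T := by
  rw [← exists_foldRel_foldPeak_iff]
  constructor
  · rintro ⟨z, h1, h2⟩
    obtain ⟨w, rfl, hw⟩ := isLimitBelow_foldLeg_iff.1 h1
    rw [isBelow_foldLeg_iff, not_le] at h2
    exact ⟨w, hw, h2⟩
  · rintro ⟨w, h1, h2⟩
    refine ⟨foldLeg T ⟨w, h1.mem_left⟩, isLimitBelow_foldLeg_iff.2 ⟨_, rfl, h1⟩, ?_⟩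
    rw [isBelow_foldLeg_iff, not_le]
    exact h2

lemma separatesThreePoints_foldLeg_zero (T : Set ℕ) : SeparatesThreePoints (foldLeg T 0) := by
  have hone {x : ℕ → ℝ} (hx : x ∈ slopeSpace) (h : x 0 = 1) : IsLUB (range x) 1 :=
    IsGreatest.isLUB ⟨⟨0, h⟩, by
      rintro _ ⟨m, rfl⟩
      exact (hx m).1.2⟩
  have hc : (fun _ => 1 / 2 : ℕ → ℝ) ∈ slopeSpace := const_mem_slopeSpace (by norm_num)
  have h1 : seqCons 1 (fun _ => 1 / 2) ∈ slopeSpace :=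
    seqCons_mem_slopeSpace hc (by norm_num) half_mem_slopes (by norm_num)
  have h2 : seqCons 1 (seqCons 1 (fun _ => 1 / 2)) ∈ slopeSpace :=
    seqCons_mem_slopeSpace h1 (by norm_num) one_mem_slopes (by norm_num [seqCons])
  refine (isLegSystem_fanLeg T).separatesThreePoints
    (j := ![constIndex, ⟨⟨_, h1⟩, hone h1 rfl⟩, ⟨⟨_, h2⟩, hone h2 rfl⟩]) ?_
  have hval (a : LegIndex) (n : ℕ) : ∀ b : LegIndex, a = b → a.1.1 n = b.1.1 n := by
    rintro b rfl
    rfl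
  intro k l hkl
  have e1 := hval _ 1 _ hkl
  have e2 := hval _ 2 _ hkl
  fin_cases k <;> fin_cases l <;> first
    | rfl
    | (norm_num [constIndex, slopeConst, seqCons] at e1; done)
    | norm_num [constIndex, slopeConst, seqCons] at e2

lemma eq_of_homeomorph {T S : Set ℕ} (e : FoldFan T ≃ₜ FoldFan S) : T = S := by
  have hv : e (foldLeg T 0) = foldLeg S 0 :=
    (isLegSystem_fanLeg S).eq_of_separatesThreePoints
      ((separatesThreePoints_foldLeg_zero T).image e)
  have hpeak (z : FoldFan T) : e z ∈ peakPoints (foldLeg S 0) ↔ z ∈ peakPoints (foldLeg T 0) := by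
    rw [← hv, mem_peakPoints_image_iff]
  have hex (k : ℕ) : ∃ l, foldLeg S (fanPeak S l) = e (foldLeg T (fanPeak T k)) := by
    rw [← mem_peakPoints_iff, hpeak, mem_peakPoints_iff]
    exact ⟨k, rfl⟩
  choose g hg using hex
  have hmono : StrictMono g := by
    refine strictMono_of_le_iff_le fun k l => ?_
    rw [← (fanPeak_strictMono T).le_iff_le, ← isBelow_foldLeg_iff, ← isBelow_image_iff e, hv,
      ← hg, ← hg, isBelow_foldLeg_iff, (fanPeak_strictMono S).le_iff_le]
  have hsurj : Function.Surjective g := by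
    intro l
    obtain ⟨z, hz⟩ := e.surjective (foldLeg S (fanPeak S l))
    obtain ⟨k, rfl⟩ := mem_peakPoints_iff.1 ((hpeak z).1 (hz ▸ mem_peakPoints_iff.2 ⟨l, rfl⟩))
    refine ⟨k, (fanPeak_strictMono S).injective (injective_foldLeg (T := S) ?_)⟩
    rw [hg, hz]
  have hid : g = id := (hmono.range_inj strictMono_id).1 (by rw [hsurj.range_eq, range_id])
  ext k
  rw [← fanPeak_mem_nonsmoothPoints_iff, ← mem_nonsmoothPoints_image_iff e, hv, ← hg, hid,
    fanPeak_mem_nonsmoothPoints_iff]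
  rfl

end FanInvariants

/-- There is an uncountable family of pairwise non-homeomorphic Lelek-like fans, each
admitting a topologically mixing continuous non-invertible (non-injective) surjection. -/
theorem statement0 :
    ∃ (Λ : Type) (X : Λ → Type) (m : ∀ l : Λ, MetricSpace (X l))
      (f : ∀ l : Λ, X l → X l),
      ¬ Countable Λ ∧
      (∀ l : Λ, letI := m l
        IsLelekLikeFan (X l) ∧ Continuous (f l) ∧ Function.Surjective (f l) ∧
          ¬ Function.Injective (f l) ∧ TopologicallyMixing (f l)) ∧
      (∀ l₁ l₂ : Λ, l₁ ≠ l₂ →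
        letI := m l₁; letI := m l₂
        IsEmpty ((X l₁) ≃ₜ (X l₂))) := by
  refine ⟨Set ℕ, FoldFan, fun T => TopologicalSpace.metrizableSpaceMetric (FoldFan T), fanShift,
    ?_, fun T => ⟨isLelekLikeFan_foldFan T, continuous_fanShift, surjective_fanShift,
      not_injective_fanShift, topologicallyMixing_fanShift⟩,
    fun T S h => ⟨fun e => h (eq_of_homeomorph e)⟩⟩
  intro hc
  have := Cardinal.mk_le_aleph0_iff.2 hc
  rw [Cardinal.mk_set, Cardinal.mk_nat] at this
  exact absurd this (not_le.2 (Cardinal.cantor _))
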